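/- Let 0 < α < 2 and let (X_t : t ∈ ℝ) be a zero-mean stationary Gaussian process with continuous paths and Cov(X_s, X_t) = e^{−|s−t|^α}. Define τ_u^+ = inf{t ≥ 0 : X_t ≤ u} and τ_u^- = sup{t ≤ 0 : X_t ≤ u}. Then, conditionally on [X_0 > u], as u → ∞, u^{2/α}(τ_u^+ − τ_u^-) converges in distribution to τ̃^+ − τ̃^-, where τ̃^+ = inf{t ≥ 0 : Ỹ_t ≤ 0}, τ̃^- = sup{t < 0 : Ỹ_t ≤ 0}, and Ỹ_t = √2 B(t) + T* − |t|^α with B a fractional Brownian motion with Hurst index α/2 independent of the standard exponential T*. -/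

import Mathlib

open MeasureTheory ProbabilityTheory Filter

/-- A real-valued stochastic process is a (zero-mean) Gaussian process if every finite
linear combination of its values has a centered Gaussian distribution. -/
def IsZeroMeanGaussianProcess {Ω : Type*} [MeasurableSpace Ω] (P : Measure Ω)
    (X : ℝ → Ω → ℝ) : Prop :=
  (∀ t, Measurable (X t)) ∧
  ∀ (n : ℕ) (t : Fin n → ℝ) (c : Fin n → ℝ),
    ∃ v : NNReal, P.map (fun ω => ∑ i, c i * X (t i) ω) = gaussianReal 0 v

namespace Excursion

/-! ### Excursion lengths of continuous paths -/

/-- First time on the right of the origin at which the path is nonpositive. -/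
noncomputable def hitTime (y : ℝ → ℝ) : ℝ := sInf {t : ℝ | 0 ≤ t ∧ y t ≤ 0}

/-- Length of the excursion above `0` straddling the origin. -/
noncomputable def excLength (y : ℝ → ℝ) : ℝ := hitTime y + hitTime fun t => y (-t)

/-- Equidistant grid on `[-ℓ, ℓ]` with mesh `ℓ / n`. -/
noncomputable def gridPt (ℓ : ℝ) (n k : ℕ) : ℝ := ℓ * (k / n - 1)

/-- The path oscillates by more than `η` over one of the `2 n` grid cells of `[-ℓ, ℓ]`. -/
def CellOsc (ℓ : ℝ) (n : ℕ) (η : ℝ) (y : ℝ → ℝ) : Prop :=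
  ∃ k < 2 * n, ∃ t ∈ Set.Icc (gridPt ℓ n k) (gridPt ℓ n (k + 1)), η < |y t - y (gridPt ℓ n k)|

/-- Vectors exceeding `η` on a window of `n + 1` consecutive coordinates. -/
def openWindow (n : ℕ) (η : ℝ) : Set (Fin (2 * n + 1) → ℝ) :=
  {v | ∃ j : Fin (n + 1), ∀ i : Fin (n + 1), η < v ⟨j + i, by omega⟩}

/-- Vectors that are at least `η` on a window of `n + 1` consecutive coordinates. -/
def closedWindow (n : ℕ) (η : ℝ) : Set (Fin (2 * n + 1) → ℝ) :=
  {v | ∃ j : Fin (n + 1), ∀ i : Fin (n + 1), η ≤ v ⟨j + i, by omega⟩}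

lemma isOpen_openWindow (n : ℕ) (η : ℝ) : IsOpen (openWindow n η) := by
  simp only [openWindow, Set.ofPred_exists, Set.ofPred_forall]
  exact isOpen_iUnion fun j => isOpen_iInter_of_finite fun i =>
    isOpen_lt continuous_const (continuous_apply _)

lemma isClosed_closedWindow (n : ℕ) (η : ℝ) : IsClosed (closedWindow n η) := by
  simp only [closedWindow, Set.ofPred_exists, Set.ofPred_forall]
  exact isClosed_iUnion_of_finite fun j => isClosed_iInter fun i =>
    isClosed_le continuous_const (continuous_apply _)

lemma hitTime_nonneg (y : ℝ → ℝ) : 0 ≤ hitTime y :=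
  Real.sInf_nonneg fun _ ht => ht.1

lemma excLength_nonneg (y : ℝ → ℝ) : 0 ≤ excLength y :=
  add_nonneg (hitTime_nonneg _) (hitTime_nonneg _)

lemma pos_of_lt_hitTime {y : ℝ → ℝ} {t : ℝ} (ht : 0 ≤ t) (h : t < hitTime y) : 0 < y t := by
  by_contra! hy
  exact (csInf_le ⟨0, fun _ hs => hs.1⟩ (show t ∈ {t : ℝ | 0 ≤ t ∧ y t ≤ 0} from ⟨ht, hy⟩)).not_gt h

lemma apply_hitTime_nonpos {y : ℝ → ℝ} (hy : Continuous y) (hne : ∃ t, 0 ≤ t ∧ y t ≤ 0) :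
    y (hitTime y) ≤ 0 := by
  have hc : IsClosed {t : ℝ | 0 ≤ t ∧ y t ≤ 0} :=
    (isClosed_le continuous_const continuous_id).inter (isClosed_le hy continuous_const)
  exact (hc.csInf_mem hne ⟨0, fun _ hs => hs.1⟩).2

lemma lt_hitTime {y : ℝ → ℝ} (hy : Continuous y) (hne : ∃ t, 0 ≤ t ∧ y t ≤ 0) {p : ℝ}
    (h : ∀ t ∈ Set.Icc 0 p, 0 < y t) : p < hitTime y := by
  by_contra! hp
  exact (apply_hitTime_nonpos hy hne).not_gt (h _ ⟨hitTime_nonneg y, hp⟩)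

lemma lt_excLength_iff {y : ℝ → ℝ} (hy : Continuous y) (h0 : 0 < y 0)
    (hne : ∃ t, 0 ≤ t ∧ y t ≤ 0) (hne' : ∃ t, 0 ≤ t ∧ y (-t) ≤ 0) {ℓ : ℝ} (hℓ : 0 ≤ ℓ) :
    ℓ < excLength y ↔ ∃ p ∈ Set.Icc 0 ℓ, ∀ t ∈ Set.Icc (p - ℓ) p, 0 < y t := by
  have hy' : Continuous fun t => y (-t) := hy.comp continuous_neg
  have hA : 0 < hitTime y := lt_hitTime hy hne fun t ht => by
    rwa [le_antisymm ht.2 ht.1]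
  have hA' : 0 < hitTime fun t => y (-t) := lt_hitTime hy' hne' fun t ht => by
    rw [le_antisymm ht.2 ht.1]; simpa using h0
  constructor
  · intro h
    obtain ⟨p, hp0, hpl, hpA, hpA'⟩ : ∃ p, 0 ≤ p ∧ p ≤ ℓ ∧ p < hitTime y ∧
        ℓ - p < hitTime fun t => y (-t) := by
      unfold excLength at h
      rcases lt_or_ge ℓ (hitTime y) with h1 | h1
      · exact ⟨ℓ, hℓ, le_rfl, h1, by linarith⟩
      · obtain ⟨p, hp1, hp2⟩ := exists_between
          (max_lt hA (show ℓ - (hitTime fun t => y (-t)) < hitTime y by linarith))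
        rw [max_lt_iff] at hp1
        exact ⟨p, hp1.1.le, by linarith, hp2, by linarith⟩
    refine ⟨p, ⟨hp0, hpl⟩, fun t ht => ?_⟩
    rcases le_total 0 t with h1 | h1
    · exact pos_of_lt_hitTime h1 (ht.2.trans_lt hpA)
    · have := pos_of_lt_hitTime (y := fun t => y (-t)) (t := -t) (by linarith)
        (by linarith [ht.1])
      simpa using this
  · rintro ⟨p, ⟨hp0, hpl⟩, h⟩
    have h1 : p < hitTime y := lt_hitTime hy hne fun t ht => h t ⟨by linarith [ht.1], ht.2⟩
    have h2 : ℓ - p < hitTime fun t => y (-t) := lt_hitTime hy' hne' fun t ht =>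
      h (-t) ⟨by linarith [ht.2], by linarith [ht.1]⟩
    unfold excLength
    linarith

lemma exists_cell {g : ℕ → ℝ} {t : ℝ} (a m : ℕ) (hm : 0 < m) (h1 : g a ≤ t) (h2 : t ≤ g (a + m)) :
    ∃ k, a ≤ k ∧ k < a + m ∧ g k ≤ t ∧ t ≤ g (k + 1) := by
  induction m with
  | zero => omega
  | succ m ih =>
    rcases le_total (g (a + m)) t with h | h
    · exact ⟨a + m, by omega, by omega, h, h2⟩
    · rcases Nat.eq_zero_or_pos m with rfl | hm'
      · exact ⟨a, le_rfl, by omega, h1, by simpa using h2⟩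
      · obtain ⟨k, hk⟩ := ih hm' h
        exact ⟨k, hk.1, by omega, hk.2.2⟩

lemma gridPt_mono {ℓ : ℝ} (hℓ : 0 ≤ ℓ) (n : ℕ) : Monotone (gridPt ℓ n) := by
  intro a b hab
  unfold gridPt
  have : (a : ℝ) ≤ b := by exact_mod_cast hab
  gcongr

lemma gridPt_add (ℓ : ℝ) {n : ℕ} (hn : 0 < n) (j : ℕ) : gridPt ℓ n (j + n) = gridPt ℓ n j + ℓ := by
  have : (n : ℝ) ≠ 0 := by positivity
  unfold gridPt
  push_cast
  field_simp
  ring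

lemma gridPt_self (ℓ : ℝ) {n : ℕ} (hn : 0 < n) : gridPt ℓ n n = 0 := by
  have : (n : ℝ) ≠ 0 := by positivity
  simp [gridPt, this]

lemma exists_pos_Icc_of_mem_openWindow {y : ℝ → ℝ} {ℓ η : ℝ} (hℓ : 0 ≤ ℓ) {n : ℕ} (hn : 0 < n)
    (hosc : ¬ CellOsc ℓ n η y)
    (h : (fun k : Fin (2 * n + 1) => y (gridPt ℓ n k)) ∈ openWindow n η) :
    ∃ p ∈ Set.Icc 0 ℓ, ∀ t ∈ Set.Icc (p - ℓ) p, 0 < y t := by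
  obtain ⟨j, hj⟩ := h
  have e := gridPt_add ℓ hn j
  refine ⟨gridPt ℓ n (j + n), ⟨?_, ?_⟩, fun t ht => ?_⟩
  · rw [← gridPt_self ℓ hn]
    exact gridPt_mono hℓ n (by omega)
  · have := gridPt_mono hℓ n (show (j : ℕ) ≤ n by omega)
    rw [gridPt_self ℓ hn] at this
    linarith
  · obtain ⟨k, hk1, hk2, hk3, hk4⟩ := exists_cell (g := gridPt ℓ n) (t := t) j n hn
      (by linarith [ht.1]) ht.2
    have h1 := hj ⟨k - j, by omega⟩
    simp only [Nat.add_sub_cancel' hk1] at h1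
    by_contra! hy
    refine hosc ⟨k, by omega, t, ⟨hk3, hk4⟩, ?_⟩
    rw [abs_sub_comm]
    exact lt_of_lt_of_le (by linarith) (le_abs_self _)

lemma mem_closedWindow_of_exists_pos_Icc {y : ℝ → ℝ} {ℓ η : ℝ} (hℓ : 0 ≤ ℓ) (hη : 0 ≤ η) {n : ℕ}
    (hn : 0 < n) (hosc : ¬ CellOsc ℓ n η y)
    (h : ∃ p ∈ Set.Icc 0 ℓ, ∀ t ∈ Set.Icc (p - ℓ) p, 0 < y t) :
    (fun k : Fin (2 * n + 1) => y (gridPt ℓ n k)) ∈ closedWindow n (-η) := by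
  obtain ⟨p, hp, h⟩ := h
  have e0 := gridPt_self ℓ hn
  obtain ⟨k, hk1, hk2, hk3, hk4⟩ := exists_cell (g := gridPt ℓ n) (t := p) n n hn
      (by linarith [hp.1]) (by rw [gridPt_add ℓ hn]; linarith [hp.2])
  have e1 := gridPt_add ℓ hn (k - n)
  have e2 := gridPt_add ℓ hn (k - n + 1)
  rw [Nat.sub_add_cancel hk1] at e1
  rw [show k - n + 1 + n = k + 1 by omega] at e2
  refine ⟨⟨k - n, by omega⟩, fun i => ?_⟩
  have hi := i.2
  rcases Nat.eq_zero_or_pos i with h0 | h0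
  · simp only [h0, add_zero]
    by_contra! hlt
    refine hosc ⟨k - n, by omega, p - ℓ, ⟨by linarith, by linarith⟩, ?_⟩
    have := h (p - ℓ) ⟨le_rfl, by linarith⟩
    exact lt_of_lt_of_le (by linarith) (le_abs_self _)
  · have := h (gridPt ℓ n (k - n + i)) ⟨?_, ?_⟩
    · simp only
      linarith
    · have := gridPt_mono hℓ n (show k - n + 1 ≤ k - n + i by omega)
      linarith
    · exact (gridPt_mono hℓ n (show k - n + i ≤ k by omega)).trans hk3

/-! ### Measurability of hitting times -/

lemma measurableSet_exists_Icc_nonpos {Ω : Type*} [MeasurableSpace Ω] {Y : ℝ → Ω → ℝ}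
    (hm : ∀ t, Measurable (Y t)) (hc : ∀ ω, Continuous fun t => Y t ω) {c : ℝ} (hc0 : 0 < c) :
    MeasurableSet {ω | ∃ t ∈ Set.Icc 0 c, Y t ω ≤ 0} := by
  have : {ω | ∃ t ∈ Set.Icc 0 c, Y t ω ≤ 0} =
      ⋂ n : ℕ, ⋃ q : {q : ℚ // (q : ℝ) ∈ Set.Ioo 0 c}, {ω | Y (q.1 : ℝ) ω < 1 / ((n : ℝ) + 1)} := by
    ext ω
    simp only [Set.mem_ofPred_eq, Set.mem_iInter, Set.mem_iUnion]
    constructor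
    · rintro ⟨t, ht, hY⟩ n
      have ho : IsOpen {s | Y s ω < 1 / ((n : ℝ) + 1)} := isOpen_lt (hc ω) continuous_const
      have hmem : t ∈ {s | Y s ω < 1 / ((n : ℝ) + 1)} :=
        lt_of_le_of_lt hY (by positivity)
      have hcl : t ∈ closure (Set.Ioo 0 c) := by rwa [closure_Ioo hc0.ne]
      obtain ⟨s, hs⟩ := mem_closure_iff.1 hcl _ ho hmem
      obtain ⟨q, hq⟩ := Rat.denseRange_cast.exists_mem_open (ho.inter isOpen_Ioo) ⟨s, hs⟩
      exact ⟨⟨q, hq.2⟩, hq.1⟩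
    · intro h
      obtain ⟨t, ht, hmin⟩ := isCompact_Icc.exists_isMinOn (Set.nonempty_Icc.2 hc0.le)
        (hc ω).continuousOn
      refine ⟨t, ht, le_of_forall_pos_lt_add fun ε hε => ?_⟩
      obtain ⟨n, hn⟩ := exists_nat_one_div_lt hε
      obtain ⟨q, hq⟩ := h n
      have := hmin (Set.Ioo_subset_Icc_self q.2)
      simp only [Set.mem_ofPred_eq] at this
      linarith
  rw [this]
  exact MeasurableSet.iInter fun n => MeasurableSet.iUnion fun q =>
    measurableSet_lt (hm _) measurable_const

lemma measurable_hitTime {Ω : Type*} [MeasurableSpace Ω] {Y : ℝ → Ω → ℝ}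
    (hm : ∀ t, Measurable (Y t)) (hc : ∀ ω, Continuous fun t => Y t ω) :
    Measurable fun ω => hitTime fun t => Y t ω := by
  refine measurable_of_Iic fun c => ?_
  rcases lt_trichotomy c 0 with h | rfl | h
  · convert! MeasurableSet.empty using 1
    ext ω
    simpa using h.trans_le (hitTime_nonneg _)
  all_goals
    have key : ∀ c : ℝ, 0 ≤ c → (fun ω => hitTime fun t => Y t ω) ⁻¹' Set.Iic c =
        {ω | ∃ t ∈ Set.Icc 0 c, Y t ω ≤ 0} ∪
          ⋂ n : ℕ, {ω | ∃ t ∈ Set.Icc 0 ((n : ℝ) + 1), Y t ω ≤ 0}ᶜ := by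
      intro c hc0
      ext ω
      simp only [Set.mem_preimage, Set.mem_Iic, Set.mem_union, Set.mem_ofPred_eq, Set.mem_iInter,
        Set.mem_compl_iff]
      constructor
      · intro hle
        by_cases hne : ∃ t, 0 ≤ t ∧ Y t ω ≤ 0
        · exact Or.inl ⟨_, ⟨hitTime_nonneg _, hle⟩, apply_hitTime_nonpos (hc ω) hne⟩
        · exact Or.inr fun n ⟨t, ht, hY⟩ => hne ⟨t, ht.1, hY⟩
      · rintro (⟨t, ht, hY⟩ | h)
        · exact (csInf_le ⟨0, fun _ hs => hs.1⟩
            (show t ∈ {t : ℝ | 0 ≤ t ∧ Y t ω ≤ 0} from ⟨ht.1, hY⟩)).trans ht.2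
        · have : {t : ℝ | 0 ≤ t ∧ Y t ω ≤ 0} = ∅ := by
            ext t
            simp only [Set.mem_ofPred_eq, Set.mem_empty_iff_false, iff_false]
            rintro ⟨ht, hY⟩
            obtain ⟨n, hn⟩ := exists_nat_ge t
            exact h n ⟨t, ⟨ht, by linarith⟩, hY⟩
          simp [hitTime, this, hc0]
    rw [key _ (by positivity)]
    refine MeasurableSet.union ?_ (MeasurableSet.iInter fun n =>
      (measurableSet_exists_Icc_nonpos hm hc (by positivity)).compl)
  · convert! measurableSet_le (hm 0) (measurable_const (a := (0:ℝ))) using 1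
    ext ω
    constructor
    · rintro ⟨t, ht, hY⟩
      rwa [← le_antisymm ht.2 ht.1] at *
    · exact fun h => ⟨0, by simp, h⟩
  · exact measurableSet_exists_Icc_nonpos hm hc h

lemma measurable_excLength {Ω : Type*} [MeasurableSpace Ω] {Y : ℝ → Ω → ℝ}
    (hm : ∀ t, Measurable (Y t)) (hc : ∀ ω, Continuous fun t => Y t ω) :
    Measurable fun ω => excLength fun t => Y t ω :=
  (measurable_hitTime hm hc).add
    (measurable_hitTime (Y := fun t => Y (-t)) (fun _ => hm _) fun ω => (hc ω).comp continuous_neg)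

/-! ### Dyadic chaining -/

lemma gridPt_two_pow_succ (ℓ : ℝ) (N k : ℕ) :
    gridPt ℓ (2 ^ (N + 1)) (2 * k) = gridPt ℓ (2 ^ N) k := by
  unfold gridPt
  push_cast
  field_simp
  ring

lemma gridPt_succ_sub (ℓ : ℝ) (n k : ℕ) : gridPt ℓ n (k + 1) - gridPt ℓ n k = ℓ / n := by
  unfold gridPt
  push_cast
  ring

lemma abs_sub_gridPt_le_of_dyadic_increments {y : ℝ → ℝ} {ℓ θ : ℝ} (hθ0 : 0 < θ) {N k : ℕ}
    (hk : k < 2 * 2 ^ N)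
    (h : ∀ M, N ≤ M → ∀ j < 2 * 2 ^ M,
      |y (gridPt ℓ (2 ^ M) (j + 1)) - y (gridPt ℓ (2 ^ M) j)| ≤ θ ^ M)
    (d j : ℕ) (hj : j ≤ 2 ^ d) :
    |y (gridPt ℓ (2 ^ (N + d)) (k * 2 ^ d + j)) - y (gridPt ℓ (2 ^ N) k)| ≤
      ∑ i ∈ Finset.range (d + 1), θ ^ (N + i) := by
  induction d generalizing j with
  | zero =>
    rcases Nat.eq_zero_or_pos j with rfl | hj0
    · simp; positivity
    · obtain rfl : j = 1 := by simp at hj; omega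
      simpa using h N le_rfl k hk
  | succ d ih =>
    have hpar := ih (j / 2) (by rw [pow_succ] at hj; omega)
    rw [← gridPt_two_pow_succ, show 2 * (k * 2 ^ d + j / 2) = k * 2 ^ (d + 1) + 2 * (j / 2) by
      ring] at hpar
    rw [Finset.sum_range_succ]
    change |y (gridPt ℓ (2 ^ (N + d + 1)) _) - _| ≤ _
    have hθ : 0 < θ ^ (N + (d + 1)) := by positivity
    rcases Nat.mod_two_eq_zero_or_one j with h2 | h2
    · rw [show 2 * (j / 2) = j by omega] at hpar
      linarith
    · have hstep := h (N + d + 1) (by omega) (k * 2 ^ (d + 1) + 2 * (j / 2)) (by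
        have e : 2 * 2 ^ (N + d + 1) = (2 * 2 ^ N) * 2 ^ (d + 1) := by ring
        have : (k + 1) * 2 ^ (d + 1) ≤ (2 * 2 ^ N) * 2 ^ (d + 1) := Nat.mul_le_mul_right _ hk
        rw [e]
        have e2 : (k + 1) * 2 ^ (d + 1) = k * 2 ^ (d + 1) + 2 ^ (d + 1) := by ring
        omega)
      rw [show k * 2 ^ (d + 1) + 2 * (j / 2) + 1 = k * 2 ^ (d + 1) + j by omega] at hstep
      calc _ ≤ _ + _ :=
            abs_sub_le _ (y (gridPt ℓ (2 ^ (N + d + 1)) (k * 2 ^ (d + 1) + 2 * (j / 2)))) _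
        _ ≤ θ ^ (N + (d + 1)) + ∑ i ∈ Finset.range (d + 1), θ ^ (N + i) := add_le_add hstep hpar
        _ = _ := add_comm _ _

lemma not_cellOsc_of_dyadic_increments {y : ℝ → ℝ} (hy : Continuous y) {ℓ θ η : ℝ} (hθ0 : 0 < θ)
    (hθ1 : θ < 1) {N : ℕ} (hη : θ ^ N / (1 - θ) ≤ η)
    (h : ∀ M, N ≤ M → ∀ j < 2 * 2 ^ M,
      |y (gridPt ℓ (2 ^ M) (j + 1)) - y (gridPt ℓ (2 ^ M) j)| ≤ θ ^ M) :
    ¬ CellOsc ℓ (2 ^ N) η y := by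
  rintro ⟨k, hk, t, ht, hlt⟩
  have hgk : ∀ d j, gridPt ℓ (2 ^ (N + d)) (j * 2 ^ d) = gridPt ℓ (2 ^ N) j := by
    intro d j
    unfold gridPt
    push_cast
    field_simp
    ring
  have hex : ∀ d, ∃ j, j ≤ 2 ^ d ∧
      |gridPt ℓ (2 ^ (N + d)) (k * 2 ^ d + j) - t| ≤ ℓ / 2 ^ N * (1 / 2) ^ d := by
    intro d
    obtain ⟨i, hi1, hi2, hi3, hi4⟩ := exists_cell (g := gridPt ℓ (2 ^ (N + d))) (t := t)
      (k * 2 ^ d) (2 ^ d) (by positivity) (by rw [hgk]; exact ht.1)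
      (by rw [show k * 2 ^ d + 2 ^ d = (k + 1) * 2 ^ d by ring, hgk]; exact ht.2)
    refine ⟨i - k * 2 ^ d, by omega, ?_⟩
    rw [Nat.add_sub_cancel' hi1, abs_sub_comm, abs_of_nonneg (by linarith)]
    have := gridPt_succ_sub ℓ (2 ^ (N + d)) i
    have e : ℓ / ((2 ^ (N + d) : ℕ) : ℝ) = ℓ / 2 ^ N * (1 / 2) ^ d := by
      push_cast
      rw [pow_add, one_div, inv_pow]
      field_simp
    linarith
  choose j hj1 hj2 using hex
  have hlim : Tendsto (fun d => gridPt ℓ (2 ^ (N + d)) (k * 2 ^ d + j d)) atTop (nhds t) := by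
    rw [tendsto_iff_norm_sub_tendsto_zero]
    refine squeeze_zero (fun _ => norm_nonneg _) hj2 ?_
    simpa using (tendsto_pow_atTop_nhds_zero_of_lt_one (r := (1 / 2 : ℝ)) (by norm_num)
      (by norm_num)).const_mul (ℓ / 2 ^ N)
  have hlim2 := (((hy.tendsto t).comp hlim).sub_const (y (gridPt ℓ (2 ^ N) k))).abs
  refine absurd (le_of_tendsto' hlim2 fun d => ?_) hlt.not_ge
  refine (abs_sub_gridPt_le_of_dyadic_increments hθ0 hk h d _ (hj1 d)).trans (le_trans ?_ hη)
  simp_rw [pow_add, ← Finset.mul_sum]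
  rw [div_eq_mul_inv]
  gcongr
  rw [← tsum_geometric_of_lt_one hθ0.le hθ1]
  exact (summable_geometric_of_lt_one hθ0.le hθ1).sum_le_tsum _ fun _ _ => by positivity

/-- Chaining bound for the oscillation over dyadic cells, under a polynomial tail bound for the
increments. -/
lemma measureReal_cellOsc_le {Ω : Type*} [MeasurableSpace Ω] {μ : Measure Ω}
    [IsProbabilityMeasure μ] {W : ℝ → Ω → ℝ} (hc : ∀ ω, Continuous fun t => W t ω)
    {α C ℓ η : ℝ} {m N : ℕ} (hα : 0 < α) (hC : 0 ≤ C) (hαm : 4 ≤ α * m) (hℓ : 0 ≤ ℓ)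
    (htail : ∀ s t x : ℝ, 0 < x → μ.real {ω | x < |W s ω - W t ω|} ≤
      C * (|s - t| ^ α) ^ m / x ^ (2 * m))
    (hη : ((2 : ℝ) ^ (-(α / 4))) ^ N / (1 - (2 : ℝ) ^ (-(α / 4))) ≤ η) :
    μ.real {ω | CellOsc ℓ (2 ^ N) η fun t => W t ω} ≤ 4 * C * (ℓ ^ α) ^ m * (1 / 2) ^ N := by
  set θ : ℝ := (2 : ℝ) ^ (-(α / 4)) with hθ
  have hθ0 : 0 < θ := by positivity
  have hθ1 : θ < 1 := Real.rpow_lt_one_of_one_lt_of_neg (by norm_num) (by linarith)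
  have hθ4 : (1 / 2 : ℝ) ^ α = θ ^ 4 := by
    rw [hθ, ← Real.rpow_natCast, ← Real.rpow_mul (by norm_num), one_div,
      Real.inv_rpow (by norm_num), ← Real.rpow_neg (by norm_num)]
    congr 1
    push_cast
    ring
  have hθm : θ ^ (2 * m) ≤ 1 / 4 := by
    rw [hθ, ← Real.rpow_natCast, ← Real.rpow_mul (by norm_num),
      show (1 / 4 : ℝ) = (2 : ℝ) ^ (-2 : ℝ) by
        rw [Real.rpow_neg (by norm_num)]; norm_num]
    refine Real.rpow_le_rpow_of_exponent_le (by norm_num) ?_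
    push_cast
    nlinarith
  have hsub : {ω | CellOsc ℓ (2 ^ N) η fun t => W t ω} ⊆
      ⋃ d : ℕ, ⋃ j ∈ Finset.range (2 * 2 ^ (N + d)),
        {ω | θ ^ (N + d) < |W (gridPt ℓ (2 ^ (N + d)) (j + 1)) ω -
          W (gridPt ℓ (2 ^ (N + d)) j) ω|} := by
    intro ω hω
    by_contra! hn
    simp only [Set.mem_iUnion, Finset.mem_range, Set.mem_ofPred_eq, not_exists, not_lt] at hn
    refine not_cellOsc_of_dyadic_increments (hc ω) hθ0 hθ1 hη (fun M hM j hj => ?_) hω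
    obtain ⟨d, rfl⟩ := Nat.exists_eq_add_of_le hM
    exact hn d j hj
  set K := 2 * C * (ℓ ^ α) ^ m with hK
  have hK0 : 0 ≤ K := by positivity
  have hone : ∀ M j : ℕ, μ {ω | θ ^ M < |W (gridPt ℓ (2 ^ M) (j + 1)) ω -
      W (gridPt ℓ (2 ^ M) j) ω|} ≤ ENNReal.ofReal (C * (ℓ ^ α) ^ m * (1 / 4) ^ M) := by
    intro M j
    rw [← ofReal_measureReal]
    refine ENNReal.ofReal_le_ofReal ((htail _ _ _ (by positivity)).trans ?_)
    rw [gridPt_succ_sub, abs_of_nonneg (by positivity)]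
    have e : (ℓ / ((2 ^ M : ℕ) : ℝ)) ^ α = ℓ ^ α * θ ^ (4 * M) := by
      rw [pow_mul, ← hθ4, ← Real.rpow_natCast, ← Real.rpow_mul (by norm_num), mul_comm α,
        Real.rpow_mul (by norm_num), ← Real.mul_rpow hℓ (by positivity)]
      congr 1
      push_cast
      rw [Real.rpow_natCast, one_div, inv_pow]
      ring
    rw [e, mul_pow, div_le_iff₀ (by positivity)]
    have : (θ ^ (4 * M)) ^ m ≤ (1 / 4) ^ M * (θ ^ M) ^ (2 * m) := by
      have e1 : (θ ^ (4 * M)) ^ m = (θ ^ (2 * m)) ^ M * (θ ^ M) ^ (2 * m) := by ring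
      rw [e1]
      gcongr
    calc C * ((ℓ ^ α) ^ m * (θ ^ (4 * M)) ^ m)
        ≤ C * ((ℓ ^ α) ^ m * ((1 / 4) ^ M * (θ ^ M) ^ (2 * m))) := by gcongr
      _ = _ := by ring
  have hlevel : ∀ d : ℕ, μ (⋃ j ∈ Finset.range (2 * 2 ^ (N + d)),
        {ω | θ ^ (N + d) < |W (gridPt ℓ (2 ^ (N + d)) (j + 1)) ω -
          W (gridPt ℓ (2 ^ (N + d)) j) ω|}) ≤ ENNReal.ofReal (K * (1 / 2) ^ N * (1 / 2) ^ d) := by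
    intro d
    refine (measure_biUnion_finset_le _ _).trans ((Finset.sum_le_sum fun j _ => hone _ j).trans ?_)
    rw [Finset.sum_const, Finset.card_range, nsmul_eq_mul, ← ENNReal.ofReal_natCast,
      ← ENNReal.ofReal_mul (by positivity)]
    refine ENNReal.ofReal_le_ofReal (le_of_eq ?_)
    push_cast
    rw [hK, mul_assoc (2 * C * (ℓ ^ α) ^ m), ← pow_add]
    have : (2 : ℝ) ^ (N + d) * (1 / 4) ^ (N + d) = (1 / 2) ^ (N + d) := by
      rw [← mul_pow]; norm_num
    rw [← this]
    ring
  have hfin : μ {ω | CellOsc ℓ (2 ^ N) η fun t => W t ω} ≤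
      ENNReal.ofReal (4 * C * (ℓ ^ α) ^ m * (1 / 2) ^ N) := by
    refine (measure_mono hsub).trans ((measure_iUnion_le _).trans
      ((ENNReal.tsum_le_tsum hlevel).trans (le_of_eq ?_)))
    have hs : Summable fun d : ℕ => K * (1 / 2) ^ N * (1 / 2 : ℝ) ^ d :=
      summable_geometric_two.mul_left _
    rw [← ENNReal.ofReal_tsum_of_nonneg (fun d => by positivity) hs, tsum_mul_left,
      tsum_geometric_two, hK]
    congr 1
    ring
  exact ENNReal.toReal_le_of_le_ofReal (by positivity) hfin

/-! ### Convergence of excursion lengths from finite-dimensional convergence -/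

lemma measureReal_le_of_ae_subset_union {Ω : Type*} [MeasurableSpace Ω] {μ : Measure Ω}
    [IsProbabilityMeasure μ] {p q r s w : Ω → Prop} {a b : ℝ}
    (h : ∀ᵐ ω ∂μ, p ω → q ω ∨ r ω ∨ s ω ∨ w ω) (hr : μ.real {ω | r ω} ≤ a)
    (hs : μ.real {ω | s ω} ≤ b) (hw : μ.real {ω | w ω} ≤ b) :
    μ.real {ω | p ω} ≤ μ.real {ω | q ω} + (a + 2 * b) := by
  have h1 : μ.real {ω | p ω} ≤ μ.real ({ω | q ω} ∪ ({ω | r ω} ∪ ({ω | s ω} ∪ {ω | w ω}))) :=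
    ENNReal.toReal_mono (measure_ne_top _ _) (measure_mono_ae h)
  have h2 := measureReal_union_le (μ := μ) {ω | q ω} ({ω | r ω} ∪ ({ω | s ω} ∪ {ω | w ω}))
  have h3 := measureReal_union_le (μ := μ) {ω | r ω} ({ω | s ω} ∪ {ω | w ω})
  have h4 := measureReal_union_le (μ := μ) {ω | s ω} {ω | w ω}
  linarith

lemma measureReal_lt_excLength_sandwich {Ω : Type*} [MeasurableSpace Ω] {μ : Measure Ω}
    [IsProbabilityMeasure μ] {Y : ℝ → Ω → ℝ} (hc : ∀ ω, Continuous fun t => Y t ω)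
    (h0 : ∀ᵐ ω ∂μ, 0 < Y 0 ω) {ℓ η a b M : ℝ} (hℓ : 0 ≤ ℓ) (hη : 0 ≤ η) (hM : 0 ≤ M) {n : ℕ}
    (hn : 0 < n) (hosc : μ.real {ω | CellOsc ℓ n η fun t => Y t ω} ≤ a)
    (hM1 : μ.real {ω | 0 ≤ Y M ω} ≤ b) (hM2 : μ.real {ω | 0 ≤ Y (-M) ω} ≤ b) :
    μ.real {ω | ℓ < excLength fun t => Y t ω} ≤
        μ.real {ω | (fun k : Fin (2 * n + 1) => Y (gridPt ℓ n k) ω) ∈ closedWindow n (-η)} +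
          (a + 2 * b) ∧
      μ.real {ω | (fun k : Fin (2 * n + 1) => Y (gridPt ℓ n k) ω) ∈ openWindow n η} ≤
        μ.real {ω | ℓ < excLength fun t => Y t ω} + (a + 2 * b) := by
  have hne : ∀ ω, ¬ 0 ≤ Y M ω → ∃ t, 0 ≤ t ∧ Y t ω ≤ 0 := fun ω h => ⟨M, hM, (not_le.1 h).le⟩
  have hne' : ∀ ω, ¬ 0 ≤ Y (-M) ω → ∃ t, 0 ≤ t ∧ Y (-t) ω ≤ 0 :=
    fun ω h => ⟨M, hM, (not_le.1 h).le⟩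
  constructor
  · refine measureReal_le_of_ae_subset_union ?_ hosc hM1 hM2
    filter_upwards [h0] with ω hω hL
    by_contra! hcon
    obtain ⟨hq, hr, hs, hw⟩ := hcon
    exact hq (mem_closedWindow_of_exists_pos_Icc hℓ hη hn hr
      ((lt_excLength_iff (hc ω) hω (hne ω hs.not_ge) (hne' ω hw.not_ge) hℓ).1 hL))
  · refine measureReal_le_of_ae_subset_union ?_ hosc hM1 hM2
    filter_upwards [h0] with ω hω hU
    by_contra! hcon
    obtain ⟨hq, hr, hs, hw⟩ := hcon
    exact hq.not_gt ((lt_excLength_iff (hc ω) hω (hne ω hs.not_ge) (hne' ω hw.not_ge) hℓ).2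
      (exists_pos_Icc_of_mem_openWindow hℓ hn hr hU))

lemma tendsto_measureReal_lt_excLength {Ω Ω' : Type*} [MeasurableSpace Ω] [MeasurableSpace Ω']
    {μ : ℝ → Measure Ω} [∀ u, IsProbabilityMeasure (μ u)] {ν : Measure Ω'} [IsProbabilityMeasure ν]
    {Y : ℝ → ℝ → Ω → ℝ} {Z : ℝ → Ω' → ℝ}
    (hYc : ∀ u ω, Continuous fun t => Y u t ω) (hZc : ∀ ω, Continuous fun t => Z t ω)
    (hY0 : ∀ᶠ u in atTop, ∀ᵐ ω ∂μ u, 0 < Y u 0 ω) (hZ0 : ∀ᵐ ω ∂ν, 0 < Z 0 ω)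
    (hopen : ∀ (n : ℕ) (t : Fin n → ℝ) (G : Set (Fin n → ℝ)), IsOpen G → ∀ ε > 0,
      ∀ᶠ u in atTop, ν.real {ω | (fun i => Z (t i) ω) ∈ G} ≤
        (μ u).real {ω | (fun i => Y u (t i) ω) ∈ G} + ε)
    (hclosed : ∀ (n : ℕ) (t : Fin n → ℝ) (F : Set (Fin n → ℝ)), IsClosed F → ∀ ε > 0,
      ∀ᶠ u in atTop, (μ u).real {ω | (fun i => Y u (t i) ω) ∈ F} ≤
        ν.real {ω | (fun i => Z (t i) ω) ∈ F} + ε)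
    (hconc : ∀ (n : ℕ) (t : Fin (2 * n + 1) → ℝ) (η : ℝ), 0 < η →
      ν.real {ω | (fun i => Z (t i) ω) ∈ closedWindow n (-η) \ openWindow n η} ≤ 2 * η)
    (hosc : ∀ ℓ η ε : ℝ, 0 ≤ ℓ → 0 < η → 0 < ε → ∃ n : ℕ, 0 < n ∧
      (∀ᶠ u in atTop, (μ u).real {ω | CellOsc ℓ n η fun t => Y u t ω} ≤ ε) ∧
      ν.real {ω | CellOsc ℓ n η fun t => Z t ω} ≤ ε)
    (hesc : ∀ ε : ℝ, 0 < ε → ∃ M : ℝ, 0 ≤ M ∧ ν.real {ω | 0 ≤ Z M ω} ≤ ε ∧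
      ν.real {ω | 0 ≤ Z (-M) ω} ≤ ε)
    {ℓ : ℝ} (hℓ : 0 ≤ ℓ) :
    Tendsto (fun u => (μ u).real {ω | ℓ < excLength fun t => Y u t ω}) atTop
      (nhds (ν.real {ω | ℓ < excLength fun t => Z t ω})) := by
  rw [Metric.tendsto_nhds]
  intro ε hε
  set δ := ε / 20 with hδ
  have hδ0 : 0 < δ := by positivity
  obtain ⟨M, hM0, hM1, hM2⟩ := hesc δ hδ0
  obtain ⟨n, hn, hn1, hn2⟩ := hosc ℓ δ δ hℓ hδ0 hδ0
  have hpt : ∀ s : ℝ, ∀ᶠ u in atTop, (μ u).real {ω | 0 ≤ Y u s ω} ≤ ν.real {ω | 0 ≤ Z s ω} + δ :=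
    fun s => hclosed 1 (fun _ => s) {v | 0 ≤ v 0}
      (isClosed_le continuous_const (continuous_apply _)) δ hδ0
  have hg := fun k : Fin (2 * n + 1) => gridPt ℓ n k
  have hνS := measureReal_lt_excLength_sandwich hZc hZ0 hℓ hδ0.le hM0 hn hn2 hM1 hM2
  have hν : ν.real {ω | (fun k : Fin (2 * n + 1) => Z (gridPt ℓ n k) ω) ∈ closedWindow n (-δ)} ≤
      ν.real {ω | (fun k : Fin (2 * n + 1) => Z (gridPt ℓ n k) ω) ∈ openWindow n δ} + 2 * δ := by
    refine le_trans ?_ (add_le_add le_rfl (hconc n (fun k => gridPt ℓ n k) δ hδ0))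
    refine (measureReal_mono ?_).trans (measureReal_union_le _ _)
    intro ω hω
    by_cases h : (fun k : Fin (2 * n + 1) => Z (gridPt ℓ n k) ω) ∈ openWindow n δ
    · exact Or.inl h
    · exact Or.inr ⟨hω, h⟩
  filter_upwards [hY0, hn1, hpt M, hpt (-M),
    hopen _ (fun k : Fin (2 * n + 1) => gridPt ℓ n k) _ (isOpen_openWindow n δ) δ hδ0,
    hclosed _ (fun k : Fin (2 * n + 1) => gridPt ℓ n k) _ (isClosed_closedWindow n (-δ)) δ hδ0]
    with u h0 h1 h2 h3 h4 h5
  have hμS := measureReal_lt_excLength_sandwich (hYc u) h0 hℓ hδ0.le hM0 hn h1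
    (h2.trans (add_le_add hM1 le_rfl)) (h3.trans (add_le_add hM2 le_rfl))
  rw [Real.dist_eq, abs_lt]
  constructor <;> linarith [hμS.1, hμS.2, hνS.1, hνS.2]

lemma measureReal_map_Ioc {Ω : Type*} [MeasurableSpace Ω] {μ : Measure Ω}
    [IsProbabilityMeasure μ] {G : Ω → ℝ} (hG : Measurable G) {a b : ℝ} (hab : a ≤ b) :
    (μ.map G).real (Set.Ioc a b) = μ.real {ω | a < G ω} - μ.real {ω | b < G ω} := by
  have hsub : {ω | b < G ω} ⊆ {ω | a < G ω} := fun ω hω => lt_of_le_of_lt hab hω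
  rw [map_measureReal_apply hG measurableSet_Ioc,
    ← measureReal_sdiff hsub (measurableSet_lt measurable_const hG)]
  congr 1
  ext ω
  simp

lemma tendsto_integral_of_tendsto_measureReal_lt {Ω Ω' : Type*} [MeasurableSpace Ω]
    [MeasurableSpace Ω'] {μ : ℝ → Measure Ω} [∀ u, IsProbabilityMeasure (μ u)] {ν : Measure Ω'}
    [IsProbabilityMeasure ν] {L : ℝ → Ω → ℝ} {K : Ω' → ℝ} (hL : ∀ u, Measurable (L u))
    (hK : Measurable K)
    (h : ∀ ℓ, Tendsto (fun u => (μ u).real {ω | ℓ < L u ω}) atTop (nhds (ν.real {ω | ℓ < K ω})))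
    (f : BoundedContinuousFunction ℝ ℝ) :
    Tendsto (fun u => ∫ ω, f (L u ω) ∂μ u) atTop (nhds (∫ ω, f (K ω) ∂ν)) := by
  let p : ℝ → ProbabilityMeasure ℝ := fun u =>
    ⟨(μ u).map (L u), Measure.isProbabilityMeasure_map (hL u).aemeasurable⟩
  let q : ProbabilityMeasure ℝ := ⟨ν.map K, Measure.isProbabilityMeasure_map hK.aemeasurable⟩
  have hpq : Tendsto p atTop (nhds q) := by
    refine IsPiSystem.tendsto_probabilityMeasure_of_tendsto_of_mem
      (S := {s | ∃ a b : ℝ, a < b ∧ Set.Ioc a b = s}) (isPiSystem_Ioc id id) ?_ ?_ ?_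
    · rintro s ⟨a, b, -, rfl⟩
      exact measurableSet_Ioc
    · intro U hU x hx
      obtain ⟨ε, hε, hsub⟩ := Metric.isOpen_iff.1 hU x hx
      refine ⟨_, ⟨x - ε / 2, x + ε / 2, by linarith, rfl⟩, Ioc_mem_nhds (by linarith) (by linarith),
        fun z hz => hsub ?_⟩
      rw [Metric.mem_ball, Real.dist_eq, abs_lt]
      constructor <;> linarith [hz.1, hz.2]
    · rintro s ⟨a, b, hab, rfl⟩
      rw [← NNReal.tendsto_coe]
      have e1 : ∀ u, ((p u (Set.Ioc a b) : NNReal) : ℝ) =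
          (μ u).real {ω | a < L u ω} - (μ u).real {ω | b < L u ω} :=
        fun u => measureReal_map_Ioc (hL u) hab.le
      have e2 : ((q (Set.Ioc a b) : NNReal) : ℝ) =
          ν.real {ω | a < K ω} - ν.real {ω | b < K ω} := measureReal_map_Ioc hK hab.le
      simp_rw [e1, e2]
      exact (h a).sub (h b)
  have := (ProbabilityMeasure.tendsto_iff_forall_integral_tendsto.1 hpq) f
  have e1 : ∀ u, ∫ x, f x ∂(p u : Measure ℝ) = ∫ ω, f (L u ω) ∂μ u := fun u =>
    integral_map (hL u).aemeasurable f.continuous.aestronglyMeasurable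
  have e2 : ∫ x, f x ∂(q : Measure ℝ) = ∫ ω, f (K ω) ∂ν :=
    integral_map hK.aemeasurable f.continuous.aestronglyMeasurable
  simpa only [e1, e2] using this

/-! ### Linear combinations of a centred Gaussian process -/

section Gaussian

variable {Ω : Type*} [MeasurableSpace Ω] {P : Measure Ω} {X : ℝ → Ω → ℝ}

lemma memLp_two_of_isZeroMeanGaussianProcess (hX : IsZeroMeanGaussianProcess P X) (t : ℝ) :
    MemLp (X t) 2 P := by
  obtain ⟨v, hv⟩ := hX.2 1 (fun _ => t) (fun _ => 1)
  simp only [Finset.univ_unique, Finset.sum_singleton, one_mul] at hv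
  have h : MemLp id 2 (P.map (X t)) := by
    rw [hv]
    exact memLp_id_gaussianReal 2
  simpa using (memLp_map_measure_iff aestronglyMeasurable_id (hX.1 t).aemeasurable).1 h

lemma integral_eq_zero_of_isZeroMeanGaussianProcess (hX : IsZeroMeanGaussianProcess P X) (t : ℝ) :
    ∫ ω, X t ω ∂P = 0 := by
  obtain ⟨v, hv⟩ := hX.2 1 (fun _ => t) (fun _ => 1)
  simp only [Finset.univ_unique, Finset.sum_singleton, one_mul] at hv
  have h := integral_map (μ := P) (hX.1 t).aemeasurable
    (f := fun x : ℝ => x) aestronglyMeasurable_id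
  rw [← h, hv, integral_id_gaussianReal]

lemma map_sum_eq_gaussianReal (hX : IsZeroMeanGaussianProcess P X) {K : ℝ → ℝ → ℝ}
    (hK : ∀ s t, ∫ ω, X s ω * X t ω ∂P = K s t) {n : ℕ} (t c : Fin n → ℝ) :
    0 ≤ ∑ i, ∑ j, c i * c j * K (t i) (t j) ∧
      P.map (fun ω => ∑ i, c i * X (t i) ω) =
        gaussianReal 0 (∑ i, ∑ j, c i * c j * K (t i) (t j)).toNNReal := by
  obtain ⟨v, hv⟩ := hX.2 n t c
  have hm : Measurable fun ω => ∑ i, c i * X (t i) ω :=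
    Finset.measurable_sum _ fun i _ => (hX.1 _).const_mul _
  have h1 : ∫ ω, (∑ i, c i * X (t i) ω) ^ 2 ∂P = v := by
    have h := integral_map (μ := P) hm.aemeasurable
      (f := fun x : ℝ => x ^ 2) (by fun_prop)
    rw [← h, hv]
    have h2 := variance_eq_integral (μ := gaussianReal 0 v) (X := id) aemeasurable_id
    rw [variance_id_gaussianReal] at h2
    simpa using h2.symm
  have h2 : ∫ ω, (∑ i, c i * X (t i) ω) ^ 2 ∂P = ∑ i, ∑ j, c i * c j * K (t i) (t j) := by
    have hint : ∀ i j, Integrable (fun ω => c i * X (t i) ω * (c j * X (t j) ω)) P := fun i j =>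
      ((memLp_two_of_isZeroMeanGaussianProcess hX _).const_mul _).integrable_mul
        ((memLp_two_of_isZeroMeanGaussianProcess hX _).const_mul _)
    simp_rw [sq, Finset.sum_mul_sum]
    rw [integral_finsetSum _ fun i _ => integrable_finsetSum _ fun j _ => hint i j]
    refine Finset.sum_congr rfl fun i _ => ?_
    rw [integral_finsetSum _ fun j _ => hint i j]
    refine Finset.sum_congr rfl fun j _ => ?_
    rw [← hK, ← integral_const_mul]
    congr 1
    ext ω
    ring
  have h3 : ∑ i, ∑ j, c i * c j * K (t i) (t j) = v := h2 ▸ h1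
  rw [h3]
  exact ⟨v.2, by simpa using hv⟩

lemma indepFun_sum_of_covariance_eq_zero [IsProbabilityMeasure P]
    (hX : IsZeroMeanGaussianProcess P X) {K : ℝ → ℝ → ℝ}
    (hK : ∀ s t, ∫ ω, X s ω * X t ω ∂P = K s t) {n : ℕ} (t c : Fin n → ℝ) (r : ℝ)
    (h0 : ∑ i, c i * K (t i) r = 0) :
    IndepFun (fun ω => ∑ i, c i * X (t i) ω) (X r) P := by
  have hm : Measurable fun ω => ∑ i, c i * X (t i) ω :=
    Finset.measurable_sum _ fun i _ => (hX.1 _).const_mul _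
  have hL2 : MemLp (fun ω => ∑ i, c i * X (t i) ω) 2 P :=
    memLp_finsetSum _ fun i _ => (memLp_two_of_isZeroMeanGaussianProcess hX _).const_mul _
  have hG : IsGaussian (P.map fun ω => (∑ i, c i * X (t i) ω, X r ω)) := by
    refine isGaussian_of_map_eq_gaussianReal fun L => ?_
    obtain ⟨v, hv⟩ := hX.2 (n + 1) (Fin.cons r t)
      (Fin.cons (L (0, 1)) fun i => L (1, 0) * c i)
    refine ⟨0, v, ?_⟩
    rw [← hv, Measure.map_map L.continuous.measurable (hm.prodMk (hX.1 r))]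
    congr 1
    ext ω
    have : ((∑ i, c i * X (t i) ω, X r ω) : ℝ × ℝ) =
        (∑ i, c i * X (t i) ω) • ((1, 0) : ℝ × ℝ) + X r ω • ((0, 1) : ℝ × ℝ) := by simp
    rw [Function.comp_apply, this, map_add, map_smul, map_smul, Fin.sum_univ_succ]
    simp only [Fin.cons_zero, Fin.cons_succ, smul_eq_mul, mul_assoc, ← Finset.mul_sum]
    ring
  refine HasGaussianLaw.indepFun_of_covariance_eq_zero hG.hasGaussianLaw ?_
  rw [covariance_eq_sub hL2 (memLp_two_of_isZeroMeanGaussianProcess hX _),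
    integral_eq_zero_of_isZeroMeanGaussianProcess hX, mul_zero, sub_zero]
  simp only [Pi.mul_apply, Finset.sum_mul]
  rw [integral_finsetSum, ← h0]
  · refine Finset.sum_congr rfl fun i _ => ?_
    rw [← hK, ← integral_const_mul]
    congr 1
    ext ω
    ring
  · exact fun i _ => ((memLp_two_of_isZeroMeanGaussianProcess hX _).const_mul _).integrable_mul
      (memLp_two_of_isZeroMeanGaussianProcess hX _)

end Gaussian

/-- Markov's inequality for the `2m`-th moment of a centred Gaussian variable. -/
lemma gaussianReal_real_abs_gt_le (m : ℕ) {v V : ℝ} (hv : 0 ≤ v) (hvV : v ≤ V) {x : ℝ}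
    (hx : 0 < x) :
    (gaussianReal 0 v.toNNReal).real {y | x < |y|} ≤
      (∫ y, y ^ (2 * m) ∂gaussianReal 0 1) * V ^ m / x ^ (2 * m) := by
  have hmom : ∫ y, y ^ (2 * m) ∂gaussianReal 0 v.toNNReal =
      v ^ m * ∫ y, y ^ (2 * m) ∂gaussianReal 0 1 := by
    have h := gaussianReal_map_const_mul (μ := 0) (v := 1) (Real.sqrt v)
    have h2 : NNReal.mk (Real.sqrt v ^ 2) (sq_nonneg _) * 1 = v.toNNReal := by
      ext
      simp [Real.sq_sqrt hv, Real.coe_toNNReal _ hv]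
    rw [h2, mul_zero] at h
    rw [← h, integral_map (by fun_prop) (by fun_prop), ← integral_const_mul]
    congr 1
    ext y
    rw [mul_pow, pow_mul, Real.sq_sqrt hv]
  have hint : Integrable (fun y : ℝ => y ^ (2 * m)) (gaussianReal 0 v.toNNReal) := by
    rcases Nat.eq_zero_or_pos m with rfl | hm
    · simp
    · have := (memLp_id_gaussianReal (μ := 0) (v := v.toNNReal)
        ((2 * m : ℕ) : NNReal)).integrable_norm_rpow
        (by simp; lia) ENNReal.coe_ne_top
      refine this.congr (Eventually.of_forall fun y => ?_)
      simp only [id, Real.norm_eq_abs, NNReal.coe_natCast, ENNReal.coe_toReal, Real.rpow_natCast]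
      exact (even_two_mul m).pow_abs y
  have hM := mul_meas_ge_le_integral_of_nonneg (μ := gaussianReal 0 v.toNNReal)
    (Eventually.of_forall fun y : ℝ => (even_two_mul m).pow_nonneg y) hint (x ^ (2 * m))
  have hI : 0 ≤ ∫ y, y ^ (2 * m) ∂gaussianReal 0 1 :=
    integral_nonneg fun y => (even_two_mul m).pow_nonneg y
  have hsub : (gaussianReal 0 v.toNNReal).real {y | x < |y|} ≤
      (gaussianReal 0 v.toNNReal).real {y | x ^ (2 * m) ≤ y ^ (2 * m)} := by
    refine measureReal_mono fun y hy => ?_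
    have := pow_le_pow_left₀ hx.le (le_of_lt hy) (2 * m)
    rwa [(even_two_mul m).pow_abs] at this
  rw [le_div_iff₀ (by positivity)]
  calc _ ≤ (gaussianReal 0 v.toNNReal).real {y | x ^ (2 * m) ≤ y ^ (2 * m)} * x ^ (2 * m) := by
        gcongr
    _ ≤ v ^ m * ∫ y, y ^ (2 * m) ∂gaussianReal 0 1 := by
        rw [mul_comm, ← hmom]; exact hM
    _ ≤ _ := by
        rw [mul_comm]; gcongr

/-! ### The overshoot of a standard Gaussian variable above a high level -/

/-- The integral of `g` against the density, up to normalization, of `u * (N - u)` given `u < N`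
for a standard Gaussian variable `N`. -/
noncomputable def overshootIntegral (u : ℝ) (g : ℝ → ℂ) : ℂ :=
  ∫ y in Set.Ioi (0 : ℝ), (Real.exp (-y - y ^ 2 / (2 * u ^ 2)) : ℂ) * g y

lemma integral_indicator_gaussianReal {u : ℝ} (hu : 0 < u) (g : ℝ → ℂ) :
    ∫ x, (Set.Ioi u).indicator (fun x => g (u * (x - u))) x ∂gaussianReal 0 1 =
      (((Real.sqrt (2 * Real.pi))⁻¹ * Real.exp (-u ^ 2 / 2) * u⁻¹ : ℝ) : ℂ) *
        overshootIntegral u g := by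
  rw [integral_gaussianReal_eq_integral_smul one_ne_zero]
  set h : ℝ → ℂ := fun y => (Set.Ioi (0 : ℝ)).indicator (fun y =>
    (((Real.sqrt (2 * Real.pi))⁻¹ * Real.exp (-u ^ 2 / 2) : ℝ) : ℂ) *
      ((Real.exp (-y - y ^ 2 / (2 * u ^ 2)) : ℂ) * g y)) y with hh
  have e1 : ∀ x, gaussianPDFReal 0 1 x •
      (Set.Ioi u).indicator (fun x => g (u * (x - u))) x = h (u * (x - u)) := by
    intro x
    by_cases hx : u < x
    · have hx' : 0 < u * (x - u) := mul_pos hu (sub_pos.2 hx)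
      rw [hh]
      simp only [Set.indicator_of_mem (Set.mem_Ioi.2 hx), Set.indicator_of_mem (Set.mem_Ioi.2 hx')]
      rw [← mul_assoc, ← Complex.ofReal_mul, Complex.real_smul, gaussianPDFReal, mul_assoc _ _
        (Real.exp _), ← Real.exp_add]
      simp only [sub_zero, NNReal.coe_one, mul_one]
      congr 4
      field_simp
      ring
    · have hx' : ¬ 0 < u * (x - u) := fun h => hx (sub_pos.1 (pos_of_mul_pos_right h hu.le))
      rw [hh]
      simp only [Set.indicator_of_notMem (fun h => hx (Set.mem_Ioi.1 h)),
        Set.indicator_of_notMem (fun h => hx' (Set.mem_Ioi.1 h)), smul_zero]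
  simp_rw [e1]
  rw [integral_sub_right_eq_self (fun x => h (u * x)) u, Measure.integral_comp_mul_left,
    abs_of_pos (inv_pos.2 hu), hh, integral_indicator measurableSet_Ioi, integral_const_mul,
    overshootIntegral, Complex.real_smul]
  push_cast
  ring

/-- Under the law of `N` conditioned on exceeding `u`, a function of the overshoot decouples from
a function of an independent variable. -/
lemma integral_cond_eq_mul_overshootIntegral {Ω : Type*} [MeasurableSpace Ω] {P : Measure Ω}
    [IsProbabilityMeasure P] {N S : Ω → ℝ} (hN : Measurable N) (hS : Measurable S)
    (hlaw : P.map N = gaussianReal 0 1) (hind : IndepFun S N P) {u : ℝ} (hu : 0 < u)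
    {h g : ℝ → ℂ} (hh : Measurable h) (hg : Measurable g) :
    ∫ ω, h (S ω) * g (u * (N ω - u)) ∂P[|{ω | u < N ω}] =
      (∫ ω, h (S ω) ∂P) * (overshootIntegral u g / overshootIntegral u 1) := by
  have hA : MeasurableSet {ω | u < N ω} := measurableSet_lt measurable_const hN
  have hint : ∀ {g : ℝ → ℂ}, Measurable g →
      ∫ ω, (Set.Ioi u).indicator (fun x => g (u * (x - u))) (N ω) ∂P =
      (((Real.sqrt (2 * Real.pi))⁻¹ * Real.exp (-u ^ 2 / 2) * u⁻¹ : ℝ) : ℂ) *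
        overshootIntegral u g := by
    intro g hg
    have hm : Measurable ((Set.Ioi u).indicator fun x => g (u * (x - u))) :=
      (hg.comp (by fun_prop)).indicator measurableSet_Ioi
    rw [← integral_indicator_gaussianReal hu, ← hlaw, integral_map hN.aemeasurable
      hm.aestronglyMeasurable]
  have hPA : ((P.real {ω | u < N ω} : ℝ) : ℂ) =
      (((Real.sqrt (2 * Real.pi))⁻¹ * Real.exp (-u ^ 2 / 2) * u⁻¹ : ℝ) : ℂ) *
        overshootIntegral u 1 := by
    rw [← hint measurable_one]
    have : ∀ ω, (Set.Ioi u).indicator (fun x => (1 : ℝ → ℂ) (u * (x - u))) (N ω) =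
        {ω | u < N ω}.indicator (fun _ => (1 : ℂ)) ω := fun ω => rfl
    simp_rw [this]
    rw [integral_indicator hA, setIntegral_const]
    simp
  have hnum : ∫ ω in {ω | u < N ω}, h (S ω) * g (u * (N ω - u)) ∂P =
      (∫ ω, h (S ω) ∂P) * ((((Real.sqrt (2 * Real.pi))⁻¹ * Real.exp (-u ^ 2 / 2) * u⁻¹ : ℝ) : ℂ) *
        overshootIntegral u g) := by
    have hm : Measurable ((Set.Ioi u).indicator fun x => g (u * (x - u))) :=
      (hg.comp (by fun_prop)).indicator measurableSet_Ioi
    rw [← hint hg, ← hind.integral_fun_comp_mul_comp hS.aemeasurable hN.aemeasurable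
      hh.aestronglyMeasurable hm.aestronglyMeasurable, ← integral_indicator hA]
    congr 1
    ext ω
    by_cases hω : u < N ω
    · rw [Set.indicator_of_mem (by exact hω), Set.indicator_of_mem (by exact hω)]
    · rw [Set.indicator_of_notMem (by exact hω), Set.indicator_of_notMem (by exact hω), mul_zero]
  have hk : (((Real.sqrt (2 * Real.pi))⁻¹ * Real.exp (-u ^ 2 / 2) * u⁻¹ : ℝ) : ℂ) ≠ 0 := by
    norm_cast
    positivity
  rw [ProbabilityTheory.cond, integral_smul_measure, hnum, ENNReal.toReal_inv, ← measureReal_def,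
    Complex.real_smul, Complex.ofReal_inv, hPA, inv_mul_eq_div, mul_left_comm,
    mul_div_mul_left _ _ hk, mul_div_assoc]

/-- The standard exponential law, as an absolutely continuous measure. -/
noncomputable def expLaw : Measure ℝ :=
  (volume.restrict (Set.Ioi 0)).withDensity fun y => ENNReal.ofReal (Real.exp (-y))

lemma expLaw_Ioi {x : ℝ} (hx : 0 ≤ x) :
    expLaw (Set.Ioi x) = ENNReal.ofReal (Real.exp (-x)) := by
  rw [expLaw, withDensity_apply _ measurableSet_Ioi, Measure.restrict_restrict measurableSet_Ioi,
    Set.Ioi_inter_Ioi, max_eq_left hx, ← integral_exp_neg_Ioi x,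
    ofReal_integral_eq_lintegral_ofReal (integrableOn_exp_neg_Ioi x)
      (Eventually.of_forall fun y => (Real.exp_pos _).le)]

lemma expLaw_le_volume (s : Set ℝ) : expLaw s ≤ volume s := by
  refine (Measure.le_iff'.1 ?_ s : expLaw s ≤ _)
  refine le_trans (b := (volume.restrict (Set.Ioi (0 : ℝ))).withDensity 1) ?_
    (by rw [withDensity_one]; exact Measure.restrict_le_self)
  refine withDensity_mono ?_
  filter_upwards [ae_restrict_mem measurableSet_Ioi] with y hy
  rw [Pi.one_apply, ENNReal.ofReal_le_one, Real.exp_le_one_iff]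
  exact neg_nonpos.2 (le_of_lt hy)

lemma map_eq_expLaw {Ω : Type*} [MeasurableSpace Ω] {Q : Measure Ω} [IsProbabilityMeasure Q]
    {T : Ω → ℝ} (hT : Measurable T)
    (hT_exp : ∀ x : ℝ, 0 ≤ x → Q {ω | x < T ω} = ENNReal.ofReal (Real.exp (-x))) :
    Q.map T = expLaw := by
  have := Measure.isProbabilityMeasure_map (μ := Q) hT.aemeasurable
  have hIoi : ∀ x, 0 ≤ x → (Q.map T) (Set.Ioi x) = expLaw (Set.Ioi x) := fun x hx => by
    rw [Measure.map_apply hT measurableSet_Ioi, expLaw_Ioi hx, ← hT_exp x hx]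
    rfl
  have huniv : expLaw Set.univ = 1 := by
    rw [← ENNReal.ofReal_one, ← Real.exp_zero, ← neg_zero, ← expLaw_Ioi le_rfl, expLaw,
      withDensity_apply _ measurableSet_Ioi, withDensity_apply _ MeasurableSet.univ,
      Measure.restrict_univ, Measure.restrict_restrict measurableSet_Ioi, Set.inter_self]
  have : IsProbabilityMeasure expLaw := ⟨huniv⟩
  refine Measure.ext_of_Iic _ _ fun x => ?_
  rw [← Set.compl_Ioi, prob_compl_eq_one_sub measurableSet_Ioi,
    prob_compl_eq_one_sub measurableSet_Ioi]
  rcases le_total 0 x with hx | hx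
  · rw [hIoi x hx]
  · have h0 := hIoi 0 le_rfl
    have h1 : expLaw (Set.Ioi 0) = 1 := by rw [expLaw_Ioi le_rfl]; simp
    have h2 := Set.Ioi_subset_Ioi hx
    rw [(prob_le_one.antisymm (by rw [← h1, ← h0]; exact measure_mono h2) :
        Q.map T (Set.Ioi x) = 1),
      (prob_le_one.antisymm (by rw [← h1]; exact measure_mono h2) : expLaw (Set.Ioi x) = 1)]

lemma integral_expLaw (g : ℝ → ℂ) :
    ∫ y, g y ∂expLaw = ∫ y in Set.Ioi (0 : ℝ), (Real.exp (-y) : ℂ) * g y := by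
  rw [expLaw, integral_withDensity_eq_integral_toReal_smul (by fun_prop)
    (Eventually.of_forall fun y => ENNReal.ofReal_lt_top)]
  simp only [ENNReal.toReal_ofReal (Real.exp_pos _).le, Complex.real_smul]

lemma tendsto_overshootIntegral {g : ℝ → ℝ → ℂ} {g₀ : ℝ → ℂ} (hm : ∀ u, Measurable (g u))
    (hb : ∀ u y, ‖g u y‖ ≤ 1) (hg : ∀ y, Tendsto (fun u => g u y) atTop (nhds (g₀ y))) :
    Tendsto (fun u => overshootIntegral u (g u)) atTop (nhds (∫ y, g₀ y ∂expLaw)) := by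
  rw [integral_expLaw]
  refine tendsto_integral_filter_of_dominated_convergence (fun y => Real.exp (-y)) ?_ ?_
    (integrableOn_exp_neg_Ioi 0) ?_
  · refine Eventually.of_forall fun u => Measurable.aestronglyMeasurable ?_
    have := hm u
    fun_prop
  · refine Eventually.of_forall fun u => Eventually.of_forall fun y => ?_
    rw [norm_mul, Complex.norm_real, Real.norm_eq_abs, abs_of_pos (Real.exp_pos _)]
    calc _ ≤ Real.exp (-y) * 1 := by
          gcongr
          · have : 0 ≤ y ^ 2 / (2 * u ^ 2) := by positivity
            linarith
          · exact hb u y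
      _ = _ := mul_one _
  · refine Eventually.of_forall fun y => Tendsto.mul ?_ (hg y)
    refine (Complex.continuous_ofReal.tendsto _).comp ((Real.continuous_exp.tendsto _).comp ?_)
    have h1 : Tendsto (fun u : ℝ => 2 * u ^ 2) atTop atTop :=
      (tendsto_pow_atTop two_ne_zero).const_mul_atTop two_pos
    simpa using (tendsto_const_nhds (x := -y)).sub (h1.const_div_atTop (y ^ 2))

lemma tendsto_overshootIntegral_div {g : ℝ → ℝ → ℂ} {g₀ : ℝ → ℂ} (hm : ∀ u, Measurable (g u))
    (hb : ∀ u y, ‖g u y‖ ≤ 1) (hg : ∀ y, Tendsto (fun u => g u y) atTop (nhds (g₀ y))) :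
    Tendsto (fun u => overshootIntegral u (g u) / overshootIntegral u 1) atTop
      (nhds (∫ y, g₀ y ∂expLaw)) := by
  have h1 : ∫ y, (1 : ℝ → ℂ) y ∂expLaw = 1 := by
    rw [integral_expLaw]
    simp only [Pi.one_apply, mul_one]
    rw [integral_complex_ofReal, integral_exp_neg_Ioi_zero, Complex.ofReal_one]
  have h2 := tendsto_overshootIntegral (g := fun _ => 1) (g₀ := 1) (fun _ => measurable_one)
    (fun _ _ => by simp) (fun _ => tendsto_const_nhds)
  rw [h1] at h2
  have h3 := (tendsto_overshootIntegral hm hb hg).div h2 one_ne_zero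
  rwa [div_one] at h3

/-! ### Convergence of finite-dimensional distributions -/

lemma eventually_measureReal_isClosed_le {Ω Ω' : Type*} [MeasurableSpace Ω] [MeasurableSpace Ω']
    {μ : ℝ → Measure Ω} [∀ u, IsProbabilityMeasure (μ u)] {ν : Measure Ω'}
    [IsProbabilityMeasure ν] {n : ℕ} {V : ℝ → Ω → Fin n → ℝ} {W : Ω' → Fin n → ℝ}
    (hV : ∀ u, Measurable (V u)) (hW : Measurable W)
    (hchar : ∀ θ : Fin n → ℝ, Tendsto
      (fun u => ∫ ω, Complex.exp (((∑ i, θ i * V u ω i : ℝ) : ℂ) * Complex.I) ∂μ u) atTop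
      (nhds (∫ ω, Complex.exp (((∑ i, θ i * W ω i : ℝ) : ℂ) * Complex.I) ∂ν)))
    {F : Set (Fin n → ℝ)} (hF : IsClosed F) {ε : ℝ} (hε : 0 < ε) :
    ∀ᶠ u in atTop, (μ u).real {ω | V u ω ∈ F} ≤ ν.real {ω | W ω ∈ F} + ε := by
  let toE : (Fin n → ℝ) → EuclideanSpace ℝ (Fin n) := WithLp.toLp 2
  have htoE : Measurable toE := by fun_prop
  let p : ℝ → ProbabilityMeasure (EuclideanSpace ℝ (Fin n)) := fun u =>
    ⟨(μ u).map (toE ∘ V u), Measure.isProbabilityMeasure_map (htoE.comp (hV u)).aemeasurable⟩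
  let q : ProbabilityMeasure (EuclideanSpace ℝ (Fin n)) :=
    ⟨ν.map (toE ∘ W), Measure.isProbabilityMeasure_map (htoE.comp hW).aemeasurable⟩
  have hcp : ∀ u θ, charFun (p u : Measure (EuclideanSpace ℝ (Fin n))) θ =
      ∫ ω, Complex.exp (((∑ i, θ i * V u ω i : ℝ) : ℂ) * Complex.I) ∂μ u := by
    intro u θ
    rw [charFun_apply]
    refine (integral_map (htoE.comp (hV u)).aemeasurable (by fun_prop)).trans ?_
    rfl
  have hcq : ∀ θ, charFun (q : Measure (EuclideanSpace ℝ (Fin n))) θ =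
      ∫ ω, Complex.exp (((∑ i, θ i * W ω i : ℝ) : ℂ) * Complex.I) ∂ν := by
    intro θ
    rw [charFun_apply]
    refine (integral_map (htoE.comp hW).aemeasurable (by fun_prop)).trans ?_
    rfl
  have hpq : Tendsto p atTop (nhds q) := by
    refine tendsto_of_seq_tendsto fun x hx => ?_
    refine ProbabilityMeasure.tendsto_of_tendsto_charFun fun θ => ?_
    have := (hchar θ).comp hx
    rw [hcq]
    refine this.congr fun k => ?_
    exact (hcp _ _).symm
  have hF' : IsClosed {x : EuclideanSpace ℝ (Fin n) | WithLp.ofLp x ∈ F} :=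
    hF.preimage (PiLp.continuous_ofLp 2 _)
  have hlim := ProbabilityMeasure.limsup_measure_closed_le_of_tendsto hpq hF'
  have hq : (q : Measure (EuclideanSpace ℝ (Fin n))) {x | WithLp.ofLp x ∈ F} =
      ν {ω | W ω ∈ F} := Measure.map_apply (htoE.comp hW) hF'.measurableSet
  have hp : ∀ u, (p u : Measure (EuclideanSpace ℝ (Fin n))) {x | WithLp.ofLp x ∈ F} =
      μ u {ω | V u ω ∈ F} := fun u => Measure.map_apply (htoE.comp (hV u)) hF'.measurableSet
  rw [hq] at hlim
  simp_rw [hp] at hlim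
  have hlt : ν {ω | W ω ∈ F} < ν {ω | W ω ∈ F} + ENNReal.ofReal ε :=
    ENNReal.lt_add_right (measure_ne_top _ _) (by simpa using hε)
  filter_upwards [eventually_lt_of_limsup_lt (hlim.trans_lt hlt)] with u hu
  have := ENNReal.toReal_mono (by simp) hu.le
  rwa [ENNReal.toReal_add (measure_ne_top _ _) ENNReal.ofReal_ne_top,
    ENNReal.toReal_ofReal hε.le] at this

lemma eventually_measureReal_isOpen_le {Ω Ω' : Type*} [MeasurableSpace Ω] [MeasurableSpace Ω']
    {μ : ℝ → Measure Ω} [∀ u, IsProbabilityMeasure (μ u)] {ν : Measure Ω'}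
    [IsProbabilityMeasure ν] {n : ℕ} {V : ℝ → Ω → Fin n → ℝ} {W : Ω' → Fin n → ℝ}
    (hV : ∀ u, Measurable (V u)) (hW : Measurable W)
    (hclosed : ∀ F : Set (Fin n → ℝ), IsClosed F → ∀ ε > 0,
      ∀ᶠ u in atTop, (μ u).real {ω | V u ω ∈ F} ≤ ν.real {ω | W ω ∈ F} + ε)
    {G : Set (Fin n → ℝ)} (hG : IsOpen G) {ε : ℝ} (hε : 0 < ε) :
    ∀ᶠ u in atTop, ν.real {ω | W ω ∈ G} ≤ (μ u).real {ω | V u ω ∈ G} + ε := by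
  filter_upwards [hclosed Gᶜ hG.isClosed_compl ε hε] with u hu
  have h1 := probReal_compl_eq_one_sub (μ := μ u) (hV u hG.measurableSet)
  have h2 := probReal_compl_eq_one_sub (μ := ν) (hW hG.measurableSet)
  have h3 : (μ u).real {ω | V u ω ∈ Gᶜ} = 1 - (μ u).real {ω | V u ω ∈ G} := h1
  have h4 : ν.real {ω | W ω ∈ Gᶜ} = 1 - ν.real {ω | W ω ∈ G} := h2
  linarith

lemma integral_exp_mul_of_map_eq_gaussianReal {Ω : Type*} [MeasurableSpace Ω] {P : Measure Ω}
    {S : Ω → ℝ} (hS : Measurable S) {v : ℝ} (hv : 0 ≤ v)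
    (h : P.map S = gaussianReal 0 v.toNNReal) (r : ℝ) :
    ∫ ω, Complex.exp (((r * S ω : ℝ) : ℂ) * Complex.I) ∂P =
      Complex.exp (-((r ^ 2 * v / 2 : ℝ) : ℂ)) := by
  have h1 := charFun_gaussianReal (μ := 0) (v := v.toNNReal) r
  rw [← h, charFun_apply_real, integral_map hS.aemeasurable (by fun_prop)] at h1
  rw [Real.coe_toNNReal _ hv] at h1
  simp only [Complex.ofReal_mul, h1]
  congr 1
  push_cast
  ring

/-- The rescaled process `u (X (u ^ (-2/α) t) - u)` around a high level `u`. -/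
noncomputable def rescaled {Ω : Type*} (α : ℝ) (X : ℝ → Ω → ℝ) (u t : ℝ) (ω : Ω) : ℝ :=
  u * (X (u ^ (-(2 / α)) * t) ω - u)

lemma abs_rescale_rpow {α u : ℝ} (hα : 0 < α) (hu : 0 < u) (t : ℝ) :
    |u ^ (-(2 / α)) * t| ^ α = |t| ^ α / u ^ 2 := by
  have h : 0 < u ^ (-(2 / α)) := Real.rpow_pos_of_pos hu _
  rw [abs_mul, abs_of_pos h, Real.mul_rpow h.le (abs_nonneg t), ← Real.rpow_mul hu.le]
  have : -(2 / α) * α = -(2 : ℕ) := by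
    field_simp
    norm_num
  rw [this, Real.rpow_neg hu.le, Real.rpow_natCast]
  field_simp

lemma tendsto_sq_mul_exp_sub_exp (a b : ℝ) :
    Tendsto (fun u : ℝ => u ^ 2 * (Real.exp (-(a / u ^ 2)) - Real.exp (-(b / u ^ 2)))) atTop
      (nhds (b - a)) := by
  have key : ∀ c : ℝ, Tendsto (fun u : ℝ => u ^ 2 * (Real.exp (-(c / u ^ 2)) - 1)) atTop
      (nhds (-c)) := by
    intro c
    have hd : HasDerivAt (fun x : ℝ => Real.exp (-(c * x))) (-c) 0 := by
      have := ((hasDerivAt_id (0 : ℝ)).const_mul c).neg.exp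
      simpa using this
    have h1 : Tendsto (fun u : ℝ => (u ^ 2)⁻¹) atTop (nhdsWithin 0 {0}ᶜ) := by
      refine tendsto_nhdsWithin_iff.2 ⟨tendsto_inv_atTop_zero.comp (tendsto_pow_atTop two_ne_zero),
        ?_⟩
      filter_upwards [eventually_gt_atTop 0] with u hu
      simp [hu.ne']
    refine (hd.tendsto_slope.comp h1).congr fun u => ?_
    simp [slope_def_field, div_eq_mul_inv, mul_comm]
  have := (key a).sub (key b)
  rw [show b - a = -a - -b by ring]
  refine this.congr fun u => ?_
  ring

section CharacteristicFunction

variable {Ω : Type*} [MeasurableSpace Ω] {P : Measure Ω}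
  {X : ℝ → Ω → ℝ} {α : ℝ}

lemma map_zero_eq_gaussianReal (hα : 0 < α) (hX : IsZeroMeanGaussianProcess P X)
    (hX_cov : ∀ s t : ℝ, ∫ ω, X s ω * X t ω ∂P = Real.exp (-|s - t| ^ α)) :
    P.map (X 0) = gaussianReal 0 1 := by
  have h := (map_sum_eq_gaussianReal hX hX_cov (fun _ : Fin 1 => 0) fun _ => 1).2
  simpa [Real.zero_rpow hα.ne'] using h

lemma measure_level_ne_zero (hα : 0 < α) (hX : IsZeroMeanGaussianProcess P X)
    (hX_cov : ∀ s t : ℝ, ∫ ω, X s ω * X t ω ∂P = Real.exp (-|s - t| ^ α)) (u : ℝ) :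
    P {ω | u < X 0 ω} ≠ 0 := by
  have h : P.map (X 0) (Set.Ioi u) = P {ω | u < X 0 ω} :=
    Measure.map_apply (hX.1 0) measurableSet_Ioi
  rw [← h, map_zero_eq_gaussianReal hα hX hX_cov]
  intro h0
  have := gaussianReal_absolutelyContinuous' 0 one_ne_zero h0
  simp at this

lemma integral_exp_rescaled [IsProbabilityMeasure P] (hα : 0 < α)
    (hX : IsZeroMeanGaussianProcess P X)
    (hX_cov : ∀ s t : ℝ, ∫ ω, X s ω * X t ω ∂P = Real.exp (-|s - t| ^ α)) {n : ℕ}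
    (t θ : Fin n → ℝ) {u : ℝ} (hu : 0 < u) :
    ∫ ω, Complex.exp (((∑ i, θ i * rescaled α X u (t i) ω : ℝ) : ℂ) * Complex.I)
        ∂P[|{ω | u < X 0 ω}] =
      Complex.exp (-((∑ i, ∑ j, θ i * θ j * (u ^ 2 * (Real.exp (-(|t i - t j| ^ α / u ^ 2)) -
          Real.exp (-((|t i| ^ α + |t j| ^ α) / u ^ 2)))) / 2 : ℝ) : ℂ)) *
        (overshootIntegral u (fun y => Complex.exp
          ((((∑ i, θ i * Real.exp (-(|t i| ^ α / u ^ 2))) * y +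
            ∑ i, θ i * (u ^ 2 * (Real.exp (-(|t i| ^ α / u ^ 2)) - Real.exp (-(0 / u ^ 2)))) : ℝ) :
              ℂ) * Complex.I)) / overshootIntegral u 1) := by
  set K : ℝ → ℝ → ℝ := fun s t => Real.exp (-|s - t| ^ α) with hK
  set s : Fin n → ℝ := fun i => u ^ (-(2 / α)) * t i with hs
  set e : Fin n → ℝ := fun i => Real.exp (-(|t i| ^ α / u ^ 2)) with he
  set c : ℝ := ∑ i, θ i * e i with hc
  have hK0 : ∀ i, K (s i) 0 = e i := fun i => by
    simp only [hK, sub_zero, hs, abs_rescale_rpow hα hu, he]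
  have hK0' : ∀ i, K 0 (s i) = e i := fun i => by
    rw [← hK0, hK]
    simp only [zero_sub, abs_neg, sub_zero]
  have hK00 : K 0 0 = 1 := by simp [hK, Real.zero_rpow hα.ne']
  have hKs : ∀ i j, K (s i) (s j) = Real.exp (-(|t i - t j| ^ α / u ^ 2)) := fun i j => by
    simp only [hK, hs, ← mul_sub, abs_rescale_rpow hα hu]
  set τ : Fin (n + 1) → ℝ := Fin.cons 0 s with hτ
  set γ : Fin (n + 1) → ℝ := Fin.cons (-c) θ with hγ
  set S : Ω → ℝ := fun ω => ∑ i, γ i * X (τ i) ω with hSdef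
  have hS : Measurable S := Finset.measurable_sum _ fun i _ => (hX.1 _).const_mul _
  have hSω : ∀ ω, S ω = -c * X 0 ω + ∑ i, θ i * X (s i) ω := fun ω => by
    simp [hSdef, hγ, hτ, Fin.sum_univ_succ]
  have hind : IndepFun S (X 0) P := by
    refine indepFun_sum_of_covariance_eq_zero hX hX_cov τ γ 0 ?_
    change ∑ i, γ i * K (τ i) 0 = 0
    simp [hγ, hτ, Fin.sum_univ_succ, hK0, hK00, hc]
  have hcc : c * c = ∑ i, ∑ j, θ i * θ j * (e i * e j) := by
    rw [hc, Finset.sum_mul_sum]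
    exact Finset.sum_congr rfl fun i _ => Finset.sum_congr rfl fun j _ => by ring
  have hvar : ∑ i, ∑ j, γ i * γ j * K (τ i) (τ j) =
      ∑ i, ∑ j, θ i * θ j * (Real.exp (-(|t i - t j| ^ α / u ^ 2)) -
        Real.exp (-((|t i| ^ α + |t j| ^ α) / u ^ 2))) := by
    have e1 : ∑ j, -c * θ j * e j = -(c * c) := by
      rw [hc, ← hc, ← neg_mul, Finset.mul_sum]
      exact Finset.sum_congr rfl fun j _ => by ring
    have e2 : ∑ j, θ j * -c * e j = -(c * c) := by
      rw [← e1]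
      exact Finset.sum_congr rfl fun j _ => by ring
    have e3 : ∀ i j, Real.exp (-((|t i| ^ α + |t j| ^ α) / u ^ 2)) = e i * e j := fun i j => by
      rw [he, ← Real.exp_add]
      congr 1
      ring
    simp only [hγ, hτ, Fin.sum_univ_succ, Fin.cons_zero, Fin.cons_succ, hK0, hK0', hK00, hKs,
      Finset.sum_add_distrib, e1, e2, e3, mul_sub, Finset.sum_sub_distrib]
    rw [← hcc]
    ring
  obtain ⟨hpos, hmap⟩ := map_sum_eq_gaussianReal hX hX_cov τ γ
  have hchar := integral_exp_mul_of_map_eq_gaussianReal hS hpos hmap u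
  have hsplit : ∀ ω, Complex.exp (((∑ i, θ i * rescaled α X u (t i) ω : ℝ) : ℂ) * Complex.I) =
      Complex.exp (((u * S ω : ℝ) : ℂ) * Complex.I) * Complex.exp (((c * (u * (X 0 ω - u)) +
        ∑ i, θ i * (u ^ 2 * (e i - Real.exp (-(0 / u ^ 2)))) : ℝ) : ℂ) * Complex.I) := by
    intro ω
    rw [← Complex.exp_add, ← add_mul, ← Complex.ofReal_add]
    congr 3
    have e1 : ∑ i, θ i * (u ^ 2 * (e i - Real.exp (-(0 / u ^ 2)))) =
        u ^ 2 * c - u ^ 2 * ∑ i, θ i := by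
      rw [hc, Finset.mul_sum, Finset.mul_sum, ← Finset.sum_sub_distrib]
      refine Finset.sum_congr rfl fun i _ => ?_
      rw [zero_div, neg_zero, Real.exp_zero]
      ring
    have e2 : ∑ i, θ i * rescaled α X u (t i) ω =
        u * ∑ i, θ i * X (s i) ω - u ^ 2 * ∑ i, θ i := by
      rw [Finset.mul_sum, Finset.mul_sum, ← Finset.sum_sub_distrib]
      refine Finset.sum_congr rfl fun i _ => ?_
      rw [rescaled]
      ring
    rw [e1, e2, hSω]
    ring
  simp_rw [hsplit]
  rw [integral_cond_eq_mul_overshootIntegral (h := fun x => Complex.exp (((u * x : ℝ) : ℂ) *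
      Complex.I)) (g := fun y => Complex.exp (((c * y +
        ∑ i, θ i * (u ^ 2 * (e i - Real.exp (-(0 / u ^ 2)))) : ℝ) : ℂ) * Complex.I)) (hX.1 0) hS
      (map_zero_eq_gaussianReal hα hX hX_cov) hind hu (by fun_prop) (by fun_prop), hchar]
  congr 4
  rw [show ∑ i, ∑ j, γ i * γ j * Real.exp (-|τ i - τ j| ^ α) =
    ∑ i, ∑ j, γ i * γ j * K (τ i) (τ j) from rfl, hvar, Finset.mul_sum, Finset.sum_div]
  refine Finset.sum_congr rfl fun i _ => ?_
  rw [Finset.mul_sum, Finset.sum_div]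
  refine Finset.sum_congr rfl fun j _ => ?_
  ring

lemma tendsto_integral_exp_rescaled [IsProbabilityMeasure P] (hα : 0 < α)
    (hX : IsZeroMeanGaussianProcess P X)
    (hX_cov : ∀ s t : ℝ, ∫ ω, X s ω * X t ω ∂P = Real.exp (-|s - t| ^ α)) {n : ℕ}
    (t θ : Fin n → ℝ) :
    Tendsto (fun u => ∫ ω, Complex.exp (((∑ i, θ i * rescaled α X u (t i) ω : ℝ) : ℂ) * Complex.I)
        ∂P[|{ω | u < X 0 ω}]) atTop
      (nhds (Complex.exp (-((∑ i, ∑ j, θ i * θ j * (|t i| ^ α + |t j| ^ α - |t i - t j| ^ α) / 2 :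
          ℝ) : ℂ)) * ∫ y, Complex.exp ((((∑ i, θ i) * y + ∑ i, θ i * (0 - |t i| ^ α) : ℝ) : ℂ) *
            Complex.I) ∂expLaw)) := by
  have hlim : Tendsto (fun u : ℝ =>
      Complex.exp (-((∑ i, ∑ j, θ i * θ j * (u ^ 2 * (Real.exp (-(|t i - t j| ^ α / u ^ 2)) -
          Real.exp (-((|t i| ^ α + |t j| ^ α) / u ^ 2)))) / 2 : ℝ) : ℂ)) *
        (overshootIntegral u (fun y => Complex.exp
          ((((∑ i, θ i * Real.exp (-(|t i| ^ α / u ^ 2))) * y +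
            ∑ i, θ i * (u ^ 2 * (Real.exp (-(|t i| ^ α / u ^ 2)) - Real.exp (-(0 / u ^ 2)))) : ℝ) :
              ℂ) * Complex.I)) / overshootIntegral u 1)) atTop
      (nhds (Complex.exp (-((∑ i, ∑ j, θ i * θ j * (|t i| ^ α + |t j| ^ α - |t i - t j| ^ α) / 2 :
          ℝ) : ℂ)) * ∫ y, Complex.exp ((((∑ i, θ i) * y + ∑ i, θ i * (0 - |t i| ^ α) : ℝ) : ℂ) *
            Complex.I) ∂expLaw)) := by
    refine Tendsto.mul ?_ (tendsto_overshootIntegral_div (fun u => by fun_prop) ?_ fun y => ?_)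
    · refine (Complex.continuous_exp.tendsto _).comp (Tendsto.neg
        ((Complex.continuous_ofReal.tendsto _).comp ?_))
      exact tendsto_finsetSum _ fun i _ => tendsto_finsetSum _ fun j _ =>
        ((tendsto_sq_mul_exp_sub_exp _ _).const_mul _).div_const 2
    · intro u y
      rw [Complex.norm_exp_ofReal_mul_I]
    · refine (Complex.continuous_exp.tendsto _).comp (Tendsto.mul_const _
        ((Complex.continuous_ofReal.tendsto _).comp (Tendsto.add (Tendsto.mul_const _ ?_) ?_)))
      · refine tendsto_finsetSum _ fun i _ => ?_
        have h1 : Tendsto (fun u : ℝ => -(|t i| ^ α / u ^ 2)) atTop (nhds 0) := by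
          simpa using ((tendsto_pow_atTop two_ne_zero).const_div_atTop (|t i| ^ α)).neg
        simpa using ((Real.continuous_exp.tendsto 0).comp h1).const_mul (θ i)
      · exact tendsto_finsetSum _ fun i _ => (tendsto_sq_mul_exp_sub_exp _ _).const_mul _
  refine hlim.congr' ?_
  filter_upwards [eventually_gt_atTop 0] with u hu
  exact (integral_exp_rescaled hα hX hX_cov t θ hu).symm

end CharacteristicFunction

lemma integral_exp_limit {α : ℝ} {Ω' : Type*} [MeasurableSpace Ω'] {Q : Measure Ω'}
    [IsProbabilityMeasure Q] {B : ℝ → Ω' → ℝ} {T : Ω' → ℝ}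
    (hB_gauss : IsZeroMeanGaussianProcess Q B)
    (hB_cov : ∀ s t : ℝ, ∫ ω, B s ω * B t ω ∂Q = (|t| ^ α + |s| ^ α - |t - s| ^ α) / 2)
    (hT_meas : Measurable T) (hT_law : Q.map T = expLaw)
    (hBT_indep : ∀ (n : ℕ) (t : Fin n → ℝ), IndepFun (fun ω i => B (t i) ω) T Q)
    {n : ℕ} (t θ : Fin n → ℝ) :
    ∫ ω, Complex.exp (((∑ i, θ i * (Real.sqrt 2 * B (t i) ω + T ω - |t i| ^ α) : ℝ) : ℂ) *
        Complex.I) ∂Q =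
      Complex.exp (-((∑ i, ∑ j, θ i * θ j * (|t i| ^ α + |t j| ^ α - |t i - t j| ^ α) / 2 :
          ℝ) : ℂ)) * ∫ y, Complex.exp ((((∑ i, θ i) * y + ∑ i, θ i * (0 - |t i| ^ α) : ℝ) : ℂ) *
            Complex.I) ∂expLaw := by
  set S : Ω' → ℝ := fun ω => ∑ i, θ i * B (t i) ω with hSdef
  have hS : Measurable S := Finset.measurable_sum _ fun i _ => (hB_gauss.1 _).const_mul _
  have hind : IndepFun S T Q :=
    (hBT_indep n t).comp (φ := fun v : Fin n → ℝ => ∑ i, θ i * v i) (by fun_prop) measurable_id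
  obtain ⟨hpos, hmap⟩ := map_sum_eq_gaussianReal hB_gauss hB_cov t θ
  have hchar := integral_exp_mul_of_map_eq_gaussianReal hS hpos hmap (Real.sqrt 2)
  have hsplit : ∀ ω, Complex.exp (((∑ i, θ i * (Real.sqrt 2 * B (t i) ω + T ω - |t i| ^ α) : ℝ) :
      ℂ) * Complex.I) = Complex.exp (((Real.sqrt 2 * S ω : ℝ) : ℂ) * Complex.I) *
        Complex.exp ((((∑ i, θ i) * T ω + ∑ i, θ i * (0 - |t i| ^ α) : ℝ) : ℂ) * Complex.I) := by
    intro ω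
    rw [← Complex.exp_add, ← add_mul, ← Complex.ofReal_add]
    congr 3
    rw [hSdef, Finset.mul_sum, Finset.sum_mul, ← Finset.sum_add_distrib, ← Finset.sum_add_distrib]
    exact Finset.sum_congr rfl fun i _ => by ring
  simp_rw [hsplit]
  rw [hind.integral_fun_comp_mul_comp (f := fun x => Complex.exp (((Real.sqrt 2 * x : ℝ) : ℂ) *
      Complex.I)) (g := fun y => Complex.exp ((((∑ i, θ i) * y + ∑ i, θ i * (0 - |t i| ^ α) : ℝ) :
        ℂ) * Complex.I)) hS.aemeasurable hT_meas.aemeasurable (by fun_prop) (by fun_prop), hchar,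
    ← hT_law, integral_map hT_meas.aemeasurable (by fun_prop)]
  congr 4
  rw [Real.sq_sqrt zero_le_two, mul_div_cancel_left₀ _ two_ne_zero]
  refine Finset.sum_congr rfl fun i _ => Finset.sum_congr rfl fun j _ => ?_
  rw [abs_sub_comm (t j)]
  ring

/-! ### Increments and oscillation of the rescaled process -/

lemma abs_exp_neg_sub_exp_neg_le {a b : ℝ} (ha : 0 ≤ a) (hb : 0 ≤ b) :
    |Real.exp (-a) - Real.exp (-b)| ≤ |a - b| := by
  have key : ∀ a b : ℝ, 0 ≤ a → a ≤ b → |Real.exp (-a) - Real.exp (-b)| ≤ |a - b| := by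
    intro a b ha hab
    have h1 : Real.exp (-b) ≤ Real.exp (-a) := Real.exp_le_exp.2 (by linarith)
    rw [abs_of_nonneg (by linarith), abs_of_nonpos (by linarith)]
    have h2 : Real.exp (-b) = Real.exp (-a) * Real.exp (-(b - a)) := by
      rw [← Real.exp_add]
      congr 1
      ring
    have h3 := Real.one_sub_le_exp_neg (b - a)
    have h4 : Real.exp (-a) ≤ 1 := Real.exp_le_one_iff.2 (by linarith)
    have h5 := Real.exp_pos (-a)
    rw [h2]
    nlinarith
  rcases le_total a b with h | h
  · exact key a b ha h
  · rw [abs_sub_comm, abs_sub_comm a]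
    exact key b a hb h

/-- The part of the rescaled process that is independent of the value at the origin. -/
noncomputable def residual {Ω : Type*} (α : ℝ) (X : ℝ → Ω → ℝ) (u t : ℝ) (ω : Ω) : ℝ :=
  u * (X (u ^ (-(2 / α)) * t) ω - Real.exp (-(|t| ^ α / u ^ 2)) * X 0 ω)

section Increments

variable {Ω : Type*} [MeasurableSpace Ω] {P : Measure Ω} {X : ℝ → Ω → ℝ} {α : ℝ}

lemma cond_real_setOf_eq_of_indepFun [IsFiniteMeasure P] {S Z : Ω → ℝ} (hZ : Measurable Z)
    (h : IndepFun S Z P) {u : ℝ} (h0 : P {ω | u < Z ω} ≠ 0) {s : Set ℝ} (hs : MeasurableSet s) :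
    (P[|{ω | u < Z ω}]).real {ω | S ω ∈ s} = P.real {ω | S ω ∈ s} := by
  have h1 := h.measure_inter_preimage_eq_mul s (Set.Ioi u) hs measurableSet_Ioi
  have hm : MeasurableSet {ω | u < Z ω} := hZ measurableSet_Ioi
  have h2 : P ({ω | u < Z ω} ∩ {ω | S ω ∈ s}) = P {ω | S ω ∈ s} * P {ω | u < Z ω} := by
    rw [Set.inter_comm]
    exact h1
  rw [measureReal_def, cond_apply hm, h2, mul_comm (P {ω | S ω ∈ s}), ← mul_assoc,
    ENNReal.inv_mul_cancel h0 (measure_ne_top _ _), one_mul, measureReal_def]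

lemma measureReal_residual_sub_gt_le [IsProbabilityMeasure P] (hα : 0 < α)
    (hX : IsZeroMeanGaussianProcess P X)
    (hX_cov : ∀ s t : ℝ, ∫ ω, X s ω * X t ω ∂P = Real.exp (-|s - t| ^ α)) {u : ℝ} (hu : 0 < u)
    (m : ℕ) (t t' x : ℝ) (hx : 0 < x) :
    (P[|{ω | u < X 0 ω}]).real {ω | x < |residual α X u t ω - residual α X u t' ω|} ≤
      (∫ y, y ^ (2 * m) ∂gaussianReal 0 1) * 2 ^ m * (|t - t'| ^ α) ^ m / x ^ (2 * m) := by
  set K : ℝ → ℝ → ℝ := fun s t => Real.exp (-|s - t| ^ α) with hK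
  set e : ℝ → ℝ := fun t => Real.exp (-(|t| ^ α / u ^ 2)) with he
  set r : ℝ := u ^ (-(2 / α)) with hr
  set τ : Fin 3 → ℝ := ![r * t, r * t', 0] with hτ
  set c : Fin 3 → ℝ := ![u, -u, -(u * (e t - e t'))] with hc
  set S : Ω → ℝ := fun ω => ∑ i, c i * X (τ i) ω with hSdef
  have hS : Measurable S := Finset.measurable_sum _ fun i _ => (hX.1 _).const_mul _
  have hSω : ∀ ω, residual α X u t ω - residual α X u t' ω = S ω := fun ω => by
    simp only [residual, hSdef, Fin.sum_univ_three, hc, hτ, he, Matrix.cons_val]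
    ring
  have hK00 : ∀ s, K s s = 1 := fun s => by simp [hK, Real.zero_rpow hα.ne']
  have hKs : ∀ s s', K (r * s) (r * s') = Real.exp (-(|s - s'| ^ α / u ^ 2)) := fun s s' => by
    simp only [hK, hr, ← mul_sub, abs_rescale_rpow hα hu]
  have hK0 : ∀ s, K (r * s) 0 = e s := fun s => by
    rw [← mul_zero r, hKs, sub_zero]
  have hK0' : ∀ s, K 0 (r * s) = e s := fun s => by
    rw [← mul_zero r, hKs, zero_sub, abs_neg]
  have hind : IndepFun S (X 0) P := by
    refine indepFun_sum_of_covariance_eq_zero hX hX_cov τ c 0 ?_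
    change ∑ i, c i * K (τ i) 0 = 0
    simp only [Fin.sum_univ_three, hc, hτ, Matrix.cons_val, hK0, hK00]
    ring
  obtain ⟨hpos, hmap⟩ := map_sum_eq_gaussianReal hX hX_cov τ c
  have hvar : ∑ i, ∑ j, c i * c j * K (τ i) (τ j) ≤ 2 * |t - t'| ^ α := by
    have h1 : ∑ i, ∑ j, c i * c j * K (τ i) (τ j) =
        u ^ 2 * (2 * (1 - Real.exp (-(|t - t'| ^ α / u ^ 2))) - (e t - e t') ^ 2) := by
      simp only [Fin.sum_univ_three, hc, hτ, Matrix.cons_val, hK0, hK0', hK00, hKs,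
        abs_sub_comm t' t]
      ring
    have h2 := Real.one_sub_le_exp_neg (|t - t'| ^ α / u ^ 2)
    calc _ ≤ u ^ 2 * (2 * (|t - t'| ^ α / u ^ 2)) := by
          rw [h1]
          gcongr
          nlinarith [sq_nonneg (e t - e t')]
      _ = _ := by field_simp
  have hs : MeasurableSet {y : ℝ | x < |y|} := measurableSet_lt measurable_const (by fun_prop)
  simp only [hSω]
  calc (P[|{ω | u < X 0 ω}]).real {ω | S ω ∈ {y : ℝ | x < |y|}}
      = P.real {ω | S ω ∈ {y : ℝ | x < |y|}} :=
        cond_real_setOf_eq_of_indepFun (hX.1 0) hind (measure_level_ne_zero hα hX hX_cov u) hs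
    _ = (P.map S).real {y : ℝ | x < |y|} := (map_measureReal_apply hS hs).symm
    _ ≤ (∫ y, y ^ (2 * m) ∂gaussianReal 0 1) * (2 * |t - t'| ^ α) ^ m / x ^ (2 * m) := by
        rw [hmap]
        exact gaussianReal_real_abs_gt_le m hpos hvar hx
    _ = _ := by rw [mul_pow, mul_assoc]

lemma measureReal_fBm_sub_gt_le (hα : 0 < α) (hX : IsZeroMeanGaussianProcess P X)
    (hX_cov : ∀ s t : ℝ, ∫ ω, X s ω * X t ω ∂P = (|t| ^ α + |s| ^ α - |t - s| ^ α) / 2)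
    (m : ℕ) (t t' x : ℝ) (hx : 0 < x) :
    P.real {ω | x < |Real.sqrt 2 * X t ω - Real.sqrt 2 * X t' ω|} ≤
      (∫ y, y ^ (2 * m) ∂gaussianReal 0 1) * 2 ^ m * (|t - t'| ^ α) ^ m / x ^ (2 * m) := by
  set c : Fin 2 → ℝ := ![Real.sqrt 2, -Real.sqrt 2] with hc
  set τ : Fin 2 → ℝ := ![t, t'] with hτ
  set S : Ω → ℝ := fun ω => ∑ i, c i * X (τ i) ω with hSdef
  have hS : Measurable S := Finset.measurable_sum _ fun i _ => (hX.1 _).const_mul _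
  have hSω : ∀ ω, Real.sqrt 2 * X t ω - Real.sqrt 2 * X t' ω = S ω := fun ω => by
    simp only [hSdef, Fin.sum_univ_two, hc, hτ, Matrix.cons_val]
    ring
  obtain ⟨hpos, hmap⟩ := map_sum_eq_gaussianReal hX hX_cov τ c
  have hvar : ∑ i, ∑ j, c i * c j * ((|τ j| ^ α + |τ i| ^ α - |τ j - τ i| ^ α) / 2) ≤
      2 * |t - t'| ^ α := by
    have h2 : Real.sqrt 2 * Real.sqrt 2 = 2 := Real.mul_self_sqrt zero_le_two
    simp only [Fin.sum_univ_two, hc, hτ, Matrix.cons_val, abs_sub_comm t' t, sub_self, abs_zero,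
      Real.zero_rpow hα.ne', neg_mul, mul_neg, h2]
    linarith
  have hs : MeasurableSet {y : ℝ | x < |y|} := measurableSet_lt measurable_const (by fun_prop)
  simp only [hSω]
  calc P.real {ω | S ω ∈ {y : ℝ | x < |y|}}
      = (P.map S).real {y : ℝ | x < |y|} := (map_measureReal_apply hS hs).symm
    _ ≤ (∫ y, y ^ (2 * m) ∂gaussianReal 0 1) * (2 * |t - t'| ^ α) ^ m / x ^ (2 * m) := by
        rw [hmap]
        exact gaussianReal_real_abs_gt_le m hpos hvar hx
    _ = _ := by rw [mul_pow, mul_assoc]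

end Increments

lemma eventually_forall_cell_abs_sub_le {g : ℝ → ℝ} (hg : Continuous g) {ℓ η : ℝ} (hℓ : 0 ≤ ℓ)
    (hη : 0 < η) :
    ∀ᶠ n : ℕ in atTop, ∀ k < 2 * n, ∀ t ∈ Set.Icc (gridPt ℓ n k) (gridPt ℓ n (k + 1)),
      |g t - g (gridPt ℓ n k)| ≤ η := by
  obtain ⟨δ, hδ, h⟩ := Metric.uniformContinuousOn_iff.1
    ((isCompact_Icc (a := -ℓ) (b := ℓ)).uniformContinuousOn_of_continuous hg.continuousOn) η hη
  have hlim : Tendsto (fun n : ℕ => ℓ / n) atTop (nhds 0) :=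
    tendsto_const_div_atTop_nhds_zero_nat ℓ
  filter_upwards [hlim.eventually_lt_const hδ, eventually_gt_atTop 0] with n hn hn0 k hk t ht
  have h0 : gridPt ℓ n 0 = -ℓ := by simp [gridPt]
  have h2 : gridPt ℓ n (2 * n) = ℓ := by
    rw [two_mul, gridPt_add ℓ hn0, gridPt_self ℓ hn0, zero_add]
  have hk0 : -ℓ ≤ gridPt ℓ n k := h0 ▸ gridPt_mono hℓ n (Nat.zero_le k)
  have hk2 : gridPt ℓ n (k + 1) ≤ ℓ := (gridPt_mono hℓ n hk).trans_eq h2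
  have hs := gridPt_succ_sub ℓ n k
  have hd : dist t (gridPt ℓ n k) < δ := by
    rw [Real.dist_eq, abs_of_nonneg (by linarith [ht.1])]
    linarith [ht.2]
  have := h t ⟨hk0.trans ht.1, ht.2.trans hk2⟩ (gridPt ℓ n k)
    ⟨hk0, (ht.1.trans ht.2).trans hk2⟩ hd
  rw [Real.dist_eq] at this
  exact this.le

/-- Dyadic grids that are fine enough for the chaining bound and for a given modulus. -/
lemma exists_dyadic_grid {α C ℓ η ε : ℝ} (hα : 0 < α) (m : ℕ) (hℓ : 0 ≤ ℓ) (hη : 0 < η)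
    (hε : 0 < ε) :
    ∃ N : ℕ, ((2 : ℝ) ^ (-(α / 4))) ^ N / (1 - (2 : ℝ) ^ (-(α / 4))) ≤ η ∧
      4 * C * (ℓ ^ α) ^ m * (1 / 2) ^ N ≤ ε ∧
      ∀ k < 2 * 2 ^ N, ∀ t ∈ Set.Icc (gridPt ℓ (2 ^ N) k) (gridPt ℓ (2 ^ N) (k + 1)),
        |(|t| ^ α - |gridPt ℓ (2 ^ N) k| ^ α)| ≤ η / 2 := by
  have hθ0 : 0 ≤ (2 : ℝ) ^ (-(α / 4)) := by positivity
  have hθ1 : (2 : ℝ) ^ (-(α / 4)) < 1 :=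
    Real.rpow_lt_one_of_one_lt_of_neg (by norm_num) (by linarith)
  have h1 : Tendsto (fun N : ℕ => ((2 : ℝ) ^ (-(α / 4))) ^ N / (1 - (2 : ℝ) ^ (-(α / 4)))) atTop
      (nhds 0) := by
    simpa using (tendsto_pow_atTop_nhds_zero_of_lt_one hθ0 hθ1).div_const
      (1 - (2 : ℝ) ^ (-(α / 4)))
  have h2 : Tendsto (fun N : ℕ => 4 * C * (ℓ ^ α) ^ m * (1 / 2) ^ N) atTop (nhds 0) := by
    simpa using (tendsto_pow_atTop_nhds_zero_of_lt_one (r := (1 / 2 : ℝ)) (by norm_num)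
      (by norm_num)).const_mul (4 * C * (ℓ ^ α) ^ m)
  have hg : Continuous fun t : ℝ => |t| ^ α :=
    continuous_abs.rpow_const fun _ => Or.inr hα.le
  have h3 := (tendsto_pow_atTop_atTop_of_one_lt (one_lt_two : (1 : ℕ) < 2)).eventually
    (eventually_forall_cell_abs_sub_le hg hℓ (half_pos hη))
  obtain ⟨N, hN⟩ := ((h1.eventually_le_const hη).and ((h2.eventually_le_const hε).and h3)).exists
  exact ⟨N, hN.1, hN.2.1, hN.2.2⟩

lemma cellOsc_of_abs_sub_le {ℓ η δ : ℝ} {n : ℕ} {y w : ℝ → ℝ}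
    (h : ∀ k < 2 * n, ∀ t ∈ Set.Icc (gridPt ℓ n k) (gridPt ℓ n (k + 1)),
      |y t - y (gridPt ℓ n k)| ≤ |w t - w (gridPt ℓ n k)| + δ)
    (hy : CellOsc ℓ n (η + δ) y) : CellOsc ℓ n η w := by
  obtain ⟨k, hk, t, ht, hlt⟩ := hy
  exact ⟨k, hk, t, ht, by linarith [h k hk t ht]⟩

lemma abs_rescaled_sub_le {Ω : Type*} {X : ℝ → Ω → ℝ} {α u : ℝ} (hu : 0 < u) {ω : Ω}
    (h0 : u < X 0 ω) (h2 : X 0 ω ≤ 2 * u) (t t' : ℝ) :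
    |rescaled α X u t ω - rescaled α X u t' ω| ≤
      |residual α X u t ω - residual α X u t' ω| + 2 * |(|t| ^ α - |t'| ^ α)| := by
  have h3 : rescaled α X u t ω - rescaled α X u t' ω =
      residual α X u t ω - residual α X u t' ω + u * X 0 ω *
        (Real.exp (-(|t| ^ α / u ^ 2)) - Real.exp (-(|t'| ^ α / u ^ 2))) := by
    simp only [rescaled, residual]
    ring
  have h4 := abs_exp_neg_sub_exp_neg_le (a := |t| ^ α / u ^ 2) (b := |t'| ^ α / u ^ 2)
    (by positivity) (by positivity)
  rw [← sub_div, abs_div, abs_of_pos (by positivity : 0 < u ^ 2)] at h4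
  have hX : 0 < X 0 ω := hu.trans h0
  rw [h3]
  refine (abs_add_le _ _).trans (add_le_add le_rfl ?_)
  rw [abs_mul, abs_of_pos (by positivity)]
  calc _ ≤ u * (2 * u) * (|(|t| ^ α - |t'| ^ α)| / u ^ 2) := by gcongr
    _ = _ := by field_simp

section Osc

variable {Ω : Type*} [MeasurableSpace Ω] {P : Measure Ω} [IsProbabilityMeasure P]
  {X : ℝ → Ω → ℝ} {α : ℝ} {Ω' : Type*} [MeasurableSpace Ω'] {Q : Measure Ω'}
  [IsProbabilityMeasure Q] {B : ℝ → Ω' → ℝ}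

lemma exists_grid_cellOsc_le (hα : 0 < α)
    (hX : IsZeroMeanGaussianProcess P X) (hX_cont : ∀ ω, Continuous fun t => X t ω)
    (hX_cov : ∀ s t : ℝ, ∫ ω, X s ω * X t ω ∂P = Real.exp (-|s - t| ^ α))
    (hB : IsZeroMeanGaussianProcess Q B) (hB_cont : ∀ ω, Continuous fun t => B t ω)
    (hB_cov : ∀ s t : ℝ, ∫ ω, B s ω * B t ω ∂Q = (|t| ^ α + |s| ^ α - |t - s| ^ α) / 2)
    (T : Ω' → ℝ)
    (hlarge : ∀ ε > 0, ∀ᶠ u in atTop, (P[|{ω | u < X 0 ω}]).real {ω | 2 * u < X 0 ω} ≤ ε)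
    (ℓ η ε : ℝ) (hℓ : 0 ≤ ℓ) (hη : 0 < η) (hε : 0 < ε) :
    ∃ n : ℕ, 0 < n ∧
      (∀ᶠ u in atTop, (P[|{ω | u < X 0 ω}]).real
        {ω | CellOsc ℓ n η fun t => rescaled α X u t ω} ≤ ε) ∧
      Q.real {ω | CellOsc ℓ n η fun t => Real.sqrt 2 * B t ω + T ω - |t| ^ α} ≤ ε := by
  obtain ⟨m, hm⟩ := exists_nat_ge (4 / α)
  have hαm : 4 ≤ α * m := by
    rwa [div_le_iff₀ hα, mul_comm] at hm
  set C : ℝ := (∫ y, y ^ (2 * m) ∂gaussianReal 0 1) * 2 ^ m with hCdef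
  have hC : 0 ≤ C :=
    mul_nonneg (integral_nonneg fun y => (even_two_mul m).pow_nonneg y) (by positivity)
  obtain ⟨N, hN1, hN2, hN3⟩ := exists_dyadic_grid (C := C) hα m hℓ (half_pos hη) (half_pos hε)
  refine ⟨2 ^ N, by positivity, ?_, ?_⟩
  · filter_upwards [hlarge (ε / 2) (half_pos hε), eventually_gt_atTop 0] with u hu1 hu
    have := cond_isProbabilityMeasure (measure_level_ne_zero hα hX hX_cov u)
    have hc : ∀ ω, Continuous fun t => residual α X u t ω := fun ω => by
      have h1 : Continuous fun t : ℝ => |t| ^ α :=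
        continuous_abs.rpow_const fun _ => Or.inr hα.le
      have h2 : Continuous fun t : ℝ => X (u ^ (-(2 / α)) * t) ω :=
        (hX_cont ω).comp (continuous_const_mul _)
      unfold residual
      fun_prop
    have hosc := measureReal_cellOsc_le (μ := P[|{ω | u < X 0 ω}]) hc hα hC hαm hℓ
      (measureReal_residual_sub_gt_le hα hX hX_cov hu m) hN1
    have hae : ∀ᵐ ω ∂P[|{ω | u < X 0 ω}], u < X 0 ω :=
      ae_cond_mem ((hX.1 0) measurableSet_Ioi)
    have hsub : (P[|{ω | u < X 0 ω}]).real
        {ω | CellOsc ℓ (2 ^ N) η fun t => rescaled α X u t ω} ≤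
        (P[|{ω | u < X 0 ω}]).real
          ({ω | CellOsc ℓ (2 ^ N) (η / 2) fun t => residual α X u t ω} ∪ {ω | 2 * u < X 0 ω}) := by
      refine ENNReal.toReal_mono (measure_ne_top _ _) (measure_mono_ae ?_)
      filter_upwards [hae] with ω h0 h
      by_cases h2 : 2 * u < X 0 ω
      · exact Or.inr h2
      · refine Or.inl (cellOsc_of_abs_sub_le (δ := η / 2) (fun k hk t ht => ?_)
          ((add_halves η).symm ▸ h))
        have h3 := abs_rescaled_sub_le (α := α) hu h0 (not_lt.1 h2) t (gridPt ℓ (2 ^ N) k)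
        linarith [hN3 k hk t ht]
    linarith [measureReal_union_le (μ := P[|{ω | u < X 0 ω}])
      {ω | CellOsc ℓ (2 ^ N) (η / 2) fun t => residual α X u t ω} {ω | 2 * u < X 0 ω}]
  · have hosc := measureReal_cellOsc_le (μ := Q) (W := fun t ω => Real.sqrt 2 * B t ω)
      (fun ω => (hB_cont ω).const_mul _) hα hC hαm hℓ (measureReal_fBm_sub_gt_le hα hB hB_cov m) hN1
    have hsub : Q.real {ω | CellOsc ℓ (2 ^ N) η fun t => Real.sqrt 2 * B t ω + T ω - |t| ^ α} ≤
        Q.real {ω | CellOsc ℓ (2 ^ N) (η / 2) fun t => Real.sqrt 2 * B t ω} := by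
      refine measureReal_mono fun ω h => ?_
      refine cellOsc_of_abs_sub_le (δ := η / 2) (fun k hk t ht => ?_) ((add_halves η).symm ▸ h)
      have h3 := hN3 k hk t ht
      have h4 := abs_sub (Real.sqrt 2 * B t ω - Real.sqrt 2 * B (gridPt ℓ (2 ^ N) k) ω)
        (|t| ^ α - |gridPt ℓ (2 ^ N) k| ^ α)
      rw [show Real.sqrt 2 * B t ω + T ω - |t| ^ α - (Real.sqrt 2 * B (gridPt ℓ (2 ^ N) k) ω + T ω -
        |gridPt ℓ (2 ^ N) k| ^ α) = Real.sqrt 2 * B t ω - Real.sqrt 2 * B (gridPt ℓ (2 ^ N) k) ω -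
          (|t| ^ α - |gridPt ℓ (2 ^ N) k| ^ α) by ring]
      linarith
    linarith

end Osc

lemma expLaw_window_le {n : ℕ} {η : ℝ} (w : Fin (2 * n + 1) → ℝ) :
    expLaw {s | (fun i => w i + s) ∈ closedWindow n (-η) \ openWindow n η} ≤
      ENNReal.ofReal (2 * η) := by
  refine (expLaw_le_volume _).trans ((Real.volume_le_diam _).trans ?_)
  have key : ∀ s s', (fun i => w i + s) ∈ closedWindow n (-η) →
      (fun i => w i + s') ∉ openWindow n η → s' - s ≤ 2 * η := by
    rintro s s' ⟨j, hj⟩ hs'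
    by_contra! hcon
    exact hs' ⟨j, fun i => by linarith [hj i]⟩
  refine Metric.ediam_le fun s hs s' hs' => ?_
  rw [edist_dist, Real.dist_eq]
  refine ENNReal.ofReal_le_ofReal (abs_sub_le_iff.2 ⟨key s' s hs'.1 hs.2, key s s' hs.1 hs'.2⟩)

lemma measureReal_window_le {Ω : Type*} [MeasurableSpace Ω] {Q : Measure Ω}
    [IsProbabilityMeasure Q] {n : ℕ} {W : Ω → Fin (2 * n + 1) → ℝ} {T : Ω → ℝ} (hW : Measurable W)
    (hT : Measurable T) (hT_law : Q.map T = expLaw) (hWT : IndepFun W T Q) {η : ℝ} (hη : 0 < η) :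
    Q.real {ω | (fun i => W ω i + T ω) ∈ closedWindow n (-η) \ openWindow n η} ≤ 2 * η := by
  have hA : MeasurableSet (closedWindow n (-η) \ openWindow n η) :=
    (isClosed_closedWindow n _).measurableSet.diff (isOpen_openWindow n _).measurableSet
  have hf : Measurable fun p : (Fin (2 * n + 1) → ℝ) × ℝ => fun i => p.1 i + p.2 := by fun_prop
  have hprod := (indepFun_iff_map_prod_eq_prod_map_map hW.aemeasurable hT.aemeasurable).1 hWT
  have := Measure.isProbabilityMeasure_map (μ := Q) hW.aemeasurable
  have := Measure.isProbabilityMeasure_map (μ := Q) hT.aemeasurable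
  refine ENNReal.toReal_le_of_le_ofReal (by positivity) ?_
  calc Q {ω | (fun i => W ω i + T ω) ∈ closedWindow n (-η) \ openWindow n η}
      = ((Q.map W).prod (Q.map T)) ((fun p : (Fin (2 * n + 1) → ℝ) × ℝ => fun i => p.1 i + p.2) ⁻¹'
          (closedWindow n (-η) \ openWindow n η)) := by
        rw [← hprod, Measure.map_apply (hW.prodMk hT) (hf hA)]
        rfl
    _ = ∫⁻ w, Q.map T {s | (fun i => w i + s) ∈ closedWindow n (-η) \ openWindow n η} ∂Q.map W :=
        Measure.prod_apply (hf hA)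
    _ ≤ ∫⁻ w, ENNReal.ofReal (2 * η) ∂Q.map W := lintegral_mono fun w => by
        rw [hT_law]
        exact expLaw_window_le w
    _ = _ := by simp

lemma eventually_measureReal_gt_le {Ω : Type*} [MeasurableSpace Ω] {Q : Measure Ω}
    [IsProbabilityMeasure Q] {Z : Ω → ℝ} (hZ : Measurable Z) {ε : ℝ} (hε : 0 < ε) :
    ∀ᶠ K in atTop, Q.real {ω | K < Z ω} ≤ ε := by
  have := Measure.isProbabilityMeasure_map (μ := Q) hZ.aemeasurable
  have h := (tendsto_cdf_atTop (Q.map Z)).const_sub 1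
  rw [sub_self] at h
  filter_upwards [h.eventually_le_const hε] with K hK
  rw [cdf_eq_real, ← probReal_compl_eq_one_sub measurableSet_Iic, Set.compl_Iic,
    map_measureReal_apply hZ measurableSet_Ioi] at hK
  exact hK

/-! ### The limit process and the excursion endpoints -/

section Limit

variable {Ω : Type*} [MeasurableSpace Ω] {Q : Measure Ω} {B : ℝ → Ω → ℝ} {T : Ω → ℝ} {α : ℝ}

lemma fBm_zero_ae_eq_zero (hα : 0 < α) (hB : IsZeroMeanGaussianProcess Q B)
    (hB_cov : ∀ s t : ℝ, ∫ ω, B s ω * B t ω ∂Q = (|t| ^ α + |s| ^ α - |t - s| ^ α) / 2) :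
    ∀ᵐ ω ∂Q, B 0 ω = 0 := by
  have h1 : ∫ ω, B 0 ω * B 0 ω ∂Q = 0 := by
    rw [hB_cov]
    simp [Real.zero_rpow hα.ne']
  have hint : Integrable (fun ω => B 0 ω * B 0 ω) Q :=
    (memLp_two_of_isZeroMeanGaussianProcess hB 0).integrable_mul
      (memLp_two_of_isZeroMeanGaussianProcess hB 0)
  have h2 := (integral_eq_zero_iff_of_nonneg (fun ω => mul_self_nonneg (B 0 ω)) hint).1 h1
  filter_upwards [h2] with ω hω
  exact mul_self_eq_zero.1 hω

lemma limit_zero_pos_ae (hα : 0 < α) (hB : IsZeroMeanGaussianProcess Q B)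
    (hB_cov : ∀ s t : ℝ, ∫ ω, B s ω * B t ω ∂Q = (|t| ^ α + |s| ^ α - |t - s| ^ α) / 2)
    (hT : Measurable T) (hT_law : Q.map T = expLaw) :
    ∀ᵐ ω ∂Q, 0 < Real.sqrt 2 * B 0 ω + T ω - |0| ^ α := by
  have hT0 : ∀ᵐ ω ∂Q, 0 < T ω := by
    have h : ∀ᵐ y ∂Q.map T, 0 < y := by
      rw [hT_law, expLaw]
      exact (withDensity_absolutelyContinuous _ _).ae_le (ae_restrict_mem measurableSet_Ioi)
    exact ae_of_ae_map hT.aemeasurable h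
  filter_upwards [fBm_zero_ae_eq_zero hα hB hB_cov, hT0] with ω h1 h2
  simpa [h1, Real.zero_rpow hα.ne'] using h2

lemma eventually_measureReal_limit_nonneg_le [IsProbabilityMeasure Q] (hα : 0 < α)
    (hB : IsZeroMeanGaussianProcess Q B)
    (hB_cov : ∀ s t : ℝ, ∫ ω, B s ω * B t ω ∂Q = (|t| ^ α + |s| ^ α - |t - s| ^ α) / 2)
    (hT : Measurable T) {ε : ℝ} (hε : 0 < ε) :
    ∀ᶠ M in atTop, ∀ t : ℝ, |t| = M →
      Q.real {ω | 0 ≤ Real.sqrt 2 * B t ω + T ω - |t| ^ α} ≤ ε := by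
  set C : ℝ := (∫ y, y ^ (2 * 1) ∂gaussianReal 0 1) * 2 ^ 1 with hC
  have h1 : Tendsto (fun M : ℝ => M ^ α / 4) atTop atTop :=
    (tendsto_rpow_atTop hα).atTop_div_const (by norm_num)
  have h2 : Tendsto (fun M : ℝ => 16 * C / M ^ α) atTop (nhds 0) :=
    (tendsto_rpow_atTop hα).const_div_atTop _
  filter_upwards [h1.eventually (eventually_measureReal_gt_le (Q := Q) hT (half_pos hε)),
    h2.eventually_le_const (half_pos hε), eventually_gt_atTop 0] with M hM1 hM2 hM0 t ht
  have hMα : 0 < M ^ α := Real.rpow_pos_of_pos hM0 _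
  have h3 := measureReal_fBm_sub_gt_le hα hB hB_cov 1 t 0 (M ^ α / 4) (by positivity)
  rw [sub_zero, ht, ← hC, show C * (M ^ α) ^ 1 / (M ^ α / 4) ^ (2 * 1) = 16 * C / M ^ α by
    field_simp; ring] at h3
  have hsub : Q.real {ω | 0 ≤ Real.sqrt 2 * B t ω + T ω - |t| ^ α} ≤
      Q.real ({ω | M ^ α / 4 < |Real.sqrt 2 * B t ω - Real.sqrt 2 * B 0 ω|} ∪
        {ω | M ^ α / 4 < T ω}) := by
    refine ENNReal.toReal_mono (measure_ne_top _ _) (measure_mono_ae ?_)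
    filter_upwards [fBm_zero_ae_eq_zero hα hB hB_cov] with ω h0 h
    by_contra hcon
    have hcon' : ¬ (M ^ α / 4 < |Real.sqrt 2 * B t ω - Real.sqrt 2 * B 0 ω| ∨ M ^ α / 4 < T ω) :=
      hcon
    have h' : 0 ≤ Real.sqrt 2 * B t ω + T ω - |t| ^ α := h
    rw [h0, mul_zero, sub_zero, not_or, not_lt, not_lt] at hcon'
    rw [ht] at h'
    linarith [le_abs_self (Real.sqrt 2 * B t ω)]
  linarith [measureReal_union_le (μ := Q)
    {ω | M ^ α / 4 < |Real.sqrt 2 * B t ω - Real.sqrt 2 * B 0 ω|} {ω | M ^ α / 4 < T ω}]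

end Limit

lemma sSup_nonpos_eq_neg_sInf (p : ℝ → Prop) :
    sSup {t : ℝ | t ≤ 0 ∧ p t} = -sInf {t : ℝ | 0 ≤ t ∧ p (-t)} := by
  rw [Real.sInf_def, neg_neg]
  congr 1
  ext t
  simp

lemma hitTime_comp_mul {x : ℝ → ℝ} {r u : ℝ} (hr : 0 < r) (hu : 0 < u) :
    hitTime (fun t => u * (x (r * t) - u)) = r⁻¹ * sInf {t : ℝ | 0 ≤ t ∧ x t ≤ u} := by
  rw [← smul_eq_mul, ← Real.sInf_smul_of_nonneg (inv_nonneg.2 hr.le), hitTime]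
  congr 1
  ext t
  rw [Set.mem_inv_smul_set_iff₀ hr.ne']
  simp only [Set.mem_ofPred_eq, smul_eq_mul, mul_nonneg_iff_of_pos_left hr]
  rw [← sub_nonpos (a := x (r * t))]
  refine and_congr_right fun _ => ⟨fun h => ?_, fun h => ?_⟩
  · exact nonpos_of_mul_nonpos_right h hu
  · exact mul_nonpos_of_nonneg_of_nonpos hu.le h

lemma excLength_rescaled {Ω : Type*} {X : ℝ → Ω → ℝ} {α u : ℝ} (hu : 0 < u) (ω : Ω) :
    excLength (fun t => rescaled α X u t ω) =
      u ^ (2 / α) * (sInf {t : ℝ | 0 ≤ t ∧ X t ω ≤ u} - sSup {t : ℝ | t ≤ 0 ∧ X t ω ≤ u}) := by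
  have hr : 0 < u ^ (-(2 / α)) := Real.rpow_pos_of_pos hu _
  have h1 := hitTime_comp_mul (x := fun t => X t ω) hr hu
  have h2 := hitTime_comp_mul (x := fun t => X (-t) ω) hr hu
  rw [sSup_nonpos_eq_neg_sInf fun t => X t ω ≤ u, sub_neg_eq_add, mul_add, excLength]
  simp only [rescaled, mul_neg]
  rw [h1, h2, Real.rpow_neg hu.le, inv_inv]

lemma excLength_eq_sub {y : ℝ → ℝ} (h0 : 0 < y 0) :
    excLength y = sInf {t : ℝ | 0 ≤ t ∧ y t ≤ 0} - sSup {t : ℝ | t < 0 ∧ y t ≤ 0} := by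
  have h : {t : ℝ | t < 0 ∧ y t ≤ 0} = {t : ℝ | t ≤ 0 ∧ y t ≤ 0} := by
    ext t
    refine and_congr_left fun ht => ⟨le_of_lt, fun h => h.lt_of_ne ?_⟩
    rintro rfl
    exact ht.not_gt h0
  rw [h, sSup_nonpos_eq_neg_sInf fun t => y t ≤ 0, sub_neg_eq_add]
  rfl

end Excursion

/-- for `0 < α < 2` and the stationary Gaussian process with covariance
`e^{-|s-t|^α}`, conditionally on `[X₀ > u]`, `u^{2/α} (τ_u⁺ - τ_u⁻)` converges in
distribution, as `u → ∞`, to `τ̃⁺ - τ̃⁻`, the endpoints of the excursion above `0` around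
the origin of `Ỹ_t = √2 B(t) + T* - |t|^α`, where `B` is a fractional Brownian motion
with Hurst index `α/2` independent of the standard exponential `T*`. -/
theorem excursion_stmt19
    (α : ℝ) (hα0 : 0 < α) (hα2 : α < 2)
    {Ω : Type*} [MeasurableSpace Ω] (P : Measure Ω) [IsProbabilityMeasure P]
    (X : ℝ → Ω → ℝ)
    (hX_gauss : IsZeroMeanGaussianProcess P X)
    (hX_cont : ∀ ω, Continuous fun t => X t ω)
    (hX_cov : ∀ s t : ℝ, ∫ ω, X s ω * X t ω ∂P = Real.exp (-|s - t| ^ α))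
    -- the limit objects: a fractional Brownian motion `B` with Hurst index `α/2` and an
    -- independent standard exponential random variable `T*`, on some probability space.
    {Ω' : Type*} [MeasurableSpace Ω'] (Q : Measure Ω') [IsProbabilityMeasure Q]
    (B : ℝ → Ω' → ℝ) (T : Ω' → ℝ)
    (hB_gauss : IsZeroMeanGaussianProcess Q B)
    (hB_cont : ∀ ω, Continuous fun t => B t ω)
    (hB_cov : ∀ s t : ℝ, ∫ ω, B s ω * B t ω ∂Q
      = (|t| ^ α + |s| ^ α - |t - s| ^ α) / 2)
    (hT_meas : Measurable T)
    (hT_exp : ∀ x : ℝ, 0 ≤ x → Q {ω | x < T ω} = ENNReal.ofReal (Real.exp (-x)))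
    (hBT_indep : ∀ (n : ℕ) (t : Fin n → ℝ),
      IndepFun (fun ω i => B (t i) ω) T Q)
    (Ytil : ℝ → Ω' → ℝ)
    (hYtil : ∀ t ω, Ytil t ω = Real.sqrt 2 * B t ω + T ω - |t| ^ α) :
    ∀ f : BoundedContinuousFunction ℝ ℝ,
      Tendsto (fun u : ℝ =>
          ∫ ω, f (u ^ (2 / α) * (sInf {t : ℝ | 0 ≤ t ∧ X t ω ≤ u}
              - sSup {t : ℝ | t ≤ 0 ∧ X t ω ≤ u})) ∂(P[|{ω | u < X 0 ω}]))
        atTop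
        (nhds (∫ ω, f (sInf {t : ℝ | 0 ≤ t ∧ Ytil t ω ≤ 0}
            - sSup {t : ℝ | t < 0 ∧ Ytil t ω ≤ 0}) ∂Q)) := by
  open Excursion in
  intro f
  obtain rfl : Ytil = fun t ω => Real.sqrt 2 * B t ω + T ω - |t| ^ α :=
    funext fun t => funext (hYtil t)
  have hT_law := map_eq_expLaw hT_meas hT_exp
  have hμ : ∀ u, IsProbabilityMeasure (P[|{ω | u < X 0 ω}]) := fun u =>
    cond_isProbabilityMeasure (measure_level_ne_zero hα0 hX_gauss hX_cov u)
  have habs : Continuous fun t : ℝ => |t| ^ α :=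
    continuous_abs.rpow_const fun _ => Or.inr hα0.le
  have hYc : ∀ u ω, Continuous fun t => rescaled α X u t ω := fun u ω =>
    (((hX_cont ω).comp (continuous_const_mul _)).sub continuous_const).const_mul u
  have hZc : ∀ ω, Continuous fun t => Real.sqrt 2 * B t ω + T ω - |t| ^ α := fun ω =>
    (((hB_cont ω).const_mul _).add continuous_const).sub habs
  have hYm : ∀ u t, Measurable (rescaled α X u t) := fun u t =>
    ((hX_gauss.1 _).sub_const u).const_mul u
  have hZm : ∀ t, Measurable fun ω => Real.sqrt 2 * B t ω + T ω - |t| ^ α := fun t =>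
    (((hB_gauss.1 t).const_mul _).add hT_meas).sub_const _
  have hZ0 := limit_zero_pos_ae hα0 hB_gauss hB_cov hT_meas hT_law
  have hclosed : ∀ (n : ℕ) (t : Fin n → ℝ) (F : Set (Fin n → ℝ)), IsClosed F → ∀ ε > 0,
      ∀ᶠ u in atTop, (P[|{ω | u < X 0 ω}]).real {ω | (fun i => rescaled α X u (t i) ω) ∈ F} ≤
        Q.real {ω | (fun i => Real.sqrt 2 * B (t i) ω + T ω - |t i| ^ α) ∈ F} + ε := by
    intro n t F hF ε hε
    refine eventually_measureReal_isClosed_le (fun u => measurable_pi_lambda _ fun i => hYm u _)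
      (measurable_pi_lambda _ fun i => hZm _) (fun θ => ?_) hF hε
    rw [integral_exp_limit hB_gauss hB_cov hT_meas hT_law hBT_indep t θ]
    exact tendsto_integral_exp_rescaled hα0 hX_gauss hX_cov t θ
  have hlarge : ∀ ε > 0, ∀ᶠ u in atTop,
      (P[|{ω | u < X 0 ω}]).real {ω | 2 * u < X 0 ω} ≤ ε := by
    intro ε hε
    obtain ⟨K, hK⟩ := (eventually_measureReal_gt_le (Q := Q) (hZm 0) (half_pos hε)).exists
    have hF : IsClosed {v : Fin 1 → ℝ | K + 1 ≤ v 0} :=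
      isClosed_le continuous_const (continuous_apply _)
    filter_upwards [hclosed 1 (fun _ => 0) _ hF (ε / 2) (half_pos hε), eventually_gt_atTop 0,
      (tendsto_pow_atTop two_ne_zero).eventually_ge_atTop (K + 1)] with u hu hu0 huK
    have h1 : (P[|{ω | u < X 0 ω}]).real {ω | 2 * u < X 0 ω} ≤
        (P[|{ω | u < X 0 ω}]).real {ω | K + 1 ≤ rescaled α X u 0 ω} := by
      refine measureReal_mono fun ω (hω : 2 * u < X 0 ω) => ?_
      change K + 1 ≤ u * (X (u ^ (-(2 / α)) * 0) ω - u)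
      rw [mul_zero]
      nlinarith
    have h2 : Q.real {ω | K + 1 ≤ Real.sqrt 2 * B 0 ω + T ω - |0| ^ α} ≤
        Q.real {ω | K < Real.sqrt 2 * B 0 ω + T ω - |0| ^ α} :=
      measureReal_mono fun ω hω => (lt_add_one K).trans_le hω
    have h3 := h1.trans (hu.trans (add_le_add (h2.trans hK) le_rfl))
    linarith
  have hlim : ∀ ℓ : ℝ, Tendsto (fun u => (P[|{ω | u < X 0 ω}]).real
      {ω | ℓ < excLength fun t => rescaled α X u t ω}) atTop
      (nhds (Q.real {ω | ℓ < excLength fun t => Real.sqrt 2 * B t ω + T ω - |t| ^ α})) := by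
    intro ℓ
    rcases lt_or_ge ℓ 0 with hℓ | hℓ
    · have h : ∀ y, ℓ < excLength y := fun y => hℓ.trans_le (excLength_nonneg y)
      simp [h]
    refine tendsto_measureReal_lt_excLength hYc hZc ?_ hZ0 ?_ hclosed ?_ ?_ ?_ hℓ
    · filter_upwards [eventually_gt_atTop 0] with u hu
      filter_upwards [ae_cond_mem (μ := P) ((hX_gauss.1 0) measurableSet_Ioi :
        MeasurableSet {ω | u < X 0 ω})] with ω (hω : u < X 0 ω)
      rw [rescaled, mul_zero]
      exact mul_pos hu (sub_pos.2 hω)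
    · intro n t G hG ε hε
      exact eventually_measureReal_isOpen_le
        (fun u => measurable_pi_lambda _ fun i => hYm u _) (measurable_pi_lambda _ fun i => hZm _)
        (hclosed n t) hG hε
    · intro n t η hη
      have hW : Measurable fun ω (i : Fin (2 * n + 1)) => Real.sqrt 2 * B (t i) ω - |t i| ^ α :=
        measurable_pi_lambda _ fun i => ((hB_gauss.1 _).const_mul _).sub_const _
      have hind : IndepFun (fun ω i => Real.sqrt 2 * B (t i) ω - |t i| ^ α) T Q :=
        (hBT_indep _ t).comp (φ := fun (v : Fin (2 * n + 1) → ℝ) i =>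
          Real.sqrt 2 * v i - |t i| ^ α) (by fun_prop) measurable_id
      have h := measureReal_window_le hW hT_meas hT_law hind hη
      simpa only [sub_add_eq_add_sub] using h
    · exact exists_grid_cellOsc_le hα0 hX_gauss hX_cont hX_cov hB_gauss hB_cont hB_cov T hlarge
    · intro ε hε
      obtain ⟨M, hM, hM0⟩ := ((eventually_measureReal_limit_nonneg_le hα0 hB_gauss hB_cov hT_meas
        hε).and (eventually_ge_atTop 0)).exists
      exact ⟨M, hM0, hM M (abs_of_nonneg hM0), hM (-M) (by rw [abs_neg, abs_of_nonneg hM0])⟩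
  have hmain := tendsto_integral_of_tendsto_measureReal_lt
    (fun u => measurable_excLength (hYm u) (hYc u)) (measurable_excLength hZm hZc) hlim f
  have hQ : ∫ ω, f (excLength fun t => Real.sqrt 2 * B t ω + T ω - |t| ^ α) ∂Q =
      ∫ ω, f (sInf {t : ℝ | 0 ≤ t ∧ Real.sqrt 2 * B t ω + T ω - |t| ^ α ≤ 0} -
        sSup {t : ℝ | t < 0 ∧ Real.sqrt 2 * B t ω + T ω - |t| ^ α ≤ 0}) ∂Q := by
    refine integral_congr_ae ?_
    filter_upwards [hZ0] with ω hω
    rw [excLength_eq_sub hω]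
  rw [hQ] at hmain
  refine hmain.congr' ?_
  filter_upwards [eventually_gt_atTop 0] with u hu
  simp only [excLength_rescaled hu]
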